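/- arXiv:0804.4896 — 2 statements merged into one kernel-verified Lean document; each statement's English description precedes it below -/
import Mathlib

section
/- Sufficient structural condition for monotony (Theorem 2): let W be a sound, loop-free, 1-safe workflow net and N_W its unfolding with morphism φ. If every cluster c of W satisfies: any two distinct transitions t1, t2 ∈ c have t1• = t2•, then the induced pre-OrchNet ℕ_W (where transitions of N_W inherit latency functions from their φ-images, possibly with arbitrary allowed latencies subject only to these equality constraints) is monotonic. -/
open scoped ENNReal Classical

/-- A Petri net: sets of places and transitions with flow given by pre/post sets,
    and initial marking `M0`. -/
structure PetriNet where
  P : Type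
  T : Type
  pre : T → Set P
  post : T → Set P
  M0 : Set P

namespace PetriNet

variable (N : PetriNet)

/-- Nodes of a net: places or transitions. -/
abbrev Node := N.P ⊕ N.T

/-- One-step flow relation. -/
def prec : N.Node → N.Node → Prop
  | Sum.inl p, Sum.inr t => p ∈ N.pre t
  | Sum.inr t, Sum.inl p => p ∈ N.post t
  | _, _ => False

/-- Causality (reflexive): reflexive-transitive closure of the flow relation. -/
def causLe : N.Node → N.Node → Prop := Relation.ReflTransGen N.prec

/-- Strict causality. -/
def causLt : N.Node → N.Node → Prop := Relation.TransGen N.prec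

/-- Conflict: `x # y` iff distinct transitions below `x` and `y` share a preset place. -/
def Conflict (x y : N.Node) : Prop :=
  ∃ t t' : N.T, t ≠ t' ∧ N.causLe (Sum.inr t) x ∧ N.causLe (Sum.inr t') y ∧
    (N.pre t ∩ N.pre t').Nonempty

/-- Concurrency. -/
def Concurrent (x y : N.Node) : Prop :=
  ¬ N.causLe x y ∧ ¬ N.causLe y x ∧ ¬ N.Conflict x y

/-- A configuration: causally closed and conflict-free set of nodes. -/
def IsConfiguration (κ : Set N.Node) : Prop :=
  (∀ x y : N.Node, N.causLe x y → y ∈ κ → x ∈ κ) ∧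
  (∀ x ∈ κ, ∀ y ∈ κ, ¬ N.Conflict x y)

/-- Maximal configuration. -/
def IsMaxConfiguration (κ : Set N.Node) : Prop :=
  N.IsConfiguration κ ∧ ∀ κ', N.IsConfiguration κ' → κ ⊆ κ' → κ' = κ

/-- A minimal place: no transition produces it. -/
def Minimal (p : N.P) : Prop := ∀ t : N.T, p ∉ N.post t

/-- Occurrence net: no self-conflict, causality a partial order with finite pasts,
    each place produced by at most one transition, `M0` the minimal places. -/
def IsOccurrenceNet : Prop :=
  (∀ x : N.Node, ¬ N.Conflict x x) ∧
  (∀ x y : N.Node, N.causLe x y → N.causLe y x → x = y) ∧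
  (∀ t : N.T, {x : N.Node | N.causLe x (Sum.inr t)}.Finite) ∧
  (∀ p : N.P, {t : N.T | p ∈ N.post t}.Subsingleton) ∧
  (N.M0 = {p : N.P | N.Minimal p})

/-! ### Timed semantics (dates, race policy) -/

/-- One step of the dating operator: a place gets the date of its producing transition
    (or its initial date if minimal), a transition is dated `max` of its preset dates
    plus its latency. -/
noncomputable def dateF (τ : N.T → ℝ≥0∞) (init : N.P → ℝ≥0∞)
    (f : N.Node → ℝ≥0∞) : N.Node → ℝ≥0∞
  | Sum.inl p => if N.Minimal p then init p else ⨆ t ∈ {t : N.T | p ∈ N.post t}, f (Sum.inr t)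
  | Sum.inr t => (⨆ p ∈ N.pre t, f (Sum.inl p)) + τ t

/-- The date of each node (least fixed point of `dateF`; on finite acyclic nets this is
    the usual recursive definition of dates). -/
noncomputable def date (τ : N.T → ℝ≥0∞) (init : N.P → ℝ≥0∞) : N.Node → ℝ≥0∞ :=
  ⨆ k, (N.dateF τ init)^[k] ⊥

/-- Execution time (latency) of a set of nodes: max of the dates of its nodes. -/
noncomputable def execTime (τ : N.T → ℝ≥0∞) (init : N.P → ℝ≥0∞) (κ : Set N.Node) : ℝ≥0∞ :=
  ⨆ x ∈ κ, N.date τ init x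

/-- Transition `t` can extend configuration `κ`: it is enabled (preset in `κ`),
    not yet fired, and firing it keeps a configuration (no conflict with `κ`). -/
def Extends (κ : Set N.Node) (t : N.T) : Prop :=
  Sum.inr t ∉ κ ∧ (∀ p ∈ N.pre t, Sum.inl p ∈ κ) ∧
  N.IsConfiguration (κ ∪ {Sum.inr t} ∪ Sum.inl '' N.post t)

/-- One step of the race policy: among the enabled transitions, one with minimal
    date fires (preempting its conflicting rivals). -/
def RaceStep (τ : N.T → ℝ≥0∞) (init : N.P → ℝ≥0∞) (κ κ' : Set N.Node) : Prop :=
  ∃ t : N.T, N.Extends κ t ∧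
    (∀ t' : N.T, N.Extends κ t' → N.date τ init (Sum.inr t) ≤ N.date τ init (Sum.inr t')) ∧
    κ' = κ ∪ {Sum.inr t} ∪ Sum.inl '' N.post t

/-- The initial configuration: the minimal places. -/
def initConf : Set N.Node := Sum.inl '' {p : N.P | N.Minimal p}

/-- `κ` is an actually occurring configuration under the race policy. -/
def Occurs (τ : N.T → ℝ≥0∞) (init : N.P → ℝ≥0∞) (κ : Set N.Node) : Prop :=
  Relation.ReflTransGen (N.RaceStep τ init) N.initConf κ ∧ ∀ t : N.T, ¬ N.Extends κ t

/-! ### Clusters -/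

/-- Closure conditions for clusters: `t ∈ c → •t ⊆ c` and `p ∈ c → p• ⊆ c`. -/
def ClusterClosed (c : Set N.Node) : Prop :=
  (∀ t : N.T, Sum.inr t ∈ c → ∀ p ∈ N.pre t, Sum.inl p ∈ c) ∧
  (∀ p : N.P, Sum.inl p ∈ c → ∀ t : N.T, p ∈ N.pre t → Sum.inr t ∈ c)

/-- A cluster: a minimal nonempty set of nodes satisfying the closure conditions. -/
def IsCluster (c : Set N.Node) : Prop :=
  c.Nonempty ∧ N.ClusterClosed c ∧
  ∀ c' : Set N.Node, c'.Nonempty → N.ClusterClosed c' → c' ⊆ c → c' = c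

/-! ### Marking semantics, workflow nets -/

/-- Firing a transition in the (1-safe, set-based) marking semantics. -/
def Fires (M : Set N.P) (t : N.T) (M' : Set N.P) : Prop :=
  N.pre t ⊆ M ∧ M' = (M \ N.pre t) ∪ N.post t

/-- Reachability between markings. -/
def Reach : Set N.P → Set N.P → Prop :=
  Relation.ReflTransGen (fun M M' => ∃ t : N.T, N.Fires M t M')

end PetriNet

open PetriNet

/-- Workflow net with source place `i` and sink place `o`. -/
def IsWorkflow (N : PetriNet) (i o : N.P) : Prop :=
  (∀ p : N.P, (∀ t : N.T, p ∉ N.post t) ↔ p = i) ∧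
  (∀ p : N.P, (∀ t : N.T, p ∉ N.pre t) ↔ p = o) ∧
  N.M0 = {i}

/-- Soundness of a workflow net. -/
def IsSound (N : PetriNet) (i o : N.P) : Prop :=
  (∀ M, N.Reach {i} M → N.Reach M {o}) ∧
  (∀ M, N.Reach {i} M → o ∈ M → M = {o}) ∧
  (∀ t : N.T, ∃ M, N.Reach {i} M ∧ N.pre t ⊆ M)

/-- 1-safety in the set-based semantics: a fired transition never re-marks a
    still-marked place. -/
def IsSafe (N : PetriNet) (i : N.P) : Prop :=
  ∀ M t M', N.Reach {i} M → N.Fires M t M' → (M \ N.pre t) ∩ N.post t = ∅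

/-- Loop-freeness: the flow relation is acyclic. -/
def LoopFree (N : PetriNet) : Prop := ∀ x : N.Node, ¬ N.causLt x x

/-- Net morphism: maps places to places and transitions to transitions, restricting
    to bijections on presets and postsets of transitions. -/
structure NetMorphism (U W : PetriNet) where
  fP : U.P → W.P
  fT : U.T → W.T
  pre_bij : ∀ t : U.T, Set.BijOn fP (U.pre t) (W.pre (fT t))
  post_bij : ∀ t : U.T, Set.BijOn fP (U.post t) (W.post (fT t))

/-- The induced map on nodes. -/
def NetMorphism.node {U W : PetriNet} (φ : NetMorphism U W) : U.Node → W.Node :=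
  Sum.map φ.fP φ.fT

/-- `(U, φ)` is (a) branching-process unfolding of `W`: `U` is an occurrence net,
    `φ` a morphism mapping the minimal places of `U` bijectively onto those of `W`,
    and every co-set of `U` matching the preset of a transition of `W` is the preset
    of exactly one transition of `U` above it. -/
def IsUnfolding (U W : PetriNet) (φ : NetMorphism U W) : Prop :=
  U.IsOccurrenceNet ∧
  Set.BijOn φ.fP {p : U.P | U.Minimal p} {p : W.P | ∀ t : W.T, p ∉ W.post t} ∧
  (∀ (X : Set U.P) (u : W.T),
    (∀ p ∈ X, ∀ q ∈ X, p = q ∨ U.Concurrent (Sum.inl p) (Sum.inl q)) →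
    Set.BijOn φ.fP X (W.pre u) →
    ∃! t : U.T, U.pre t = X ∧ φ.fT t = u)

namespace PetriNet

def linkR (N : PetriNet) (x y : N.Node) : Prop :=
  ∃ p t, p ∈ N.pre t ∧ x = Sum.inl p ∧ y = Sum.inr t

def SameC (N : PetriNet) (x y : N.Node) : Prop := Relation.EqvGen N.linkR x y

lemma sameC_closed_iff (N : PetriNet) (c : Set N.Node) (hc : N.ClusterClosed c)
    {x y : N.Node} (h : N.SameC x y) : x ∈ c ↔ y ∈ c := by
  induction h with
  | rel x y h =>
    obtain ⟨p, t, hp, rfl, rfl⟩ := h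
    exact ⟨fun h => hc.2 p h t hp, fun h => hc.1 t h p hp⟩
  | refl x => rfl
  | symm x y _ ih => exact ih.symm
  | trans x y z _ _ h1 h2 => exact h1.trans h2

lemma sameC_cluster (N : PetriNet) (x : N.Node) : N.IsCluster {y | N.SameC x y} := by
  refine ⟨⟨x, .refl x⟩, ⟨?_, ?_⟩, ?_⟩
  · intro t ht p hp
    exact .trans _ _ _ ht (.symm _ _ (.rel _ _ ⟨p, t, hp, rfl, rfl⟩))
  · intro p hp' t hp
    exact .trans _ _ _ hp' (.rel _ _ ⟨p, t, hp, rfl, rfl⟩)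
  · intro c' ⟨z, hz⟩ hc hsub
    apply Set.Subset.antisymm hsub
    intro y hy
    have h1 : N.SameC x z := hsub hz
    exact (sameC_closed_iff N c' hc (.trans _ _ _ (.symm _ _ h1) hy)).1 hz

lemma sameC_share (N : PetriNet) {p : N.P} {t t' : N.T} (h : p ∈ N.pre t) (h' : p ∈ N.pre t') :
    N.SameC (Sum.inr t) (Sum.inr t') :=
  .trans _ _ _ (.symm _ _ (.rel _ _ ⟨p, t, h, rfl, rfl⟩)) (.rel _ _ ⟨p, t', h', rfl, rfl⟩)

lemma prec_pre (N : PetriNet) {p : N.P} {t : N.T} (h : p ∈ N.pre t) :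
    N.prec (Sum.inl p) (Sum.inr t) := h
lemma prec_post (N : PetriNet) {p : N.P} {t : N.T} (h : p ∈ N.post t) :
    N.prec (Sum.inr t) (Sum.inl p) := h

/-- The collected consequences used for `W`. -/
structure Good (W : PetriNet) (i o : W.P) : Prop where
  wf : IsWorkflow W i o
  sound : IsSound W i o
  safe : IsSafe W i
  loopfree : LoopFree W
  clus : ∀ t1 t2 : W.T, W.SameC (Sum.inr t1) (Sum.inr t2) → W.post t1 = W.post t2

variable {W : PetriNet} {i o : W.P}

lemma fires_reach {M M' M0 : Set W.P} {t : W.T} (h0 : W.Reach M0 M) (h : W.Fires M t M') :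
    W.Reach M0 M' := Relation.ReflTransGen.tail h0 ⟨t, h⟩

lemma Good.post_empty (g : Good W i o) {u : W.T} (h : W.pre u = ∅) : W.post u = ∅ := by
  have f1 : W.Fires {i} u ({i} ∪ W.post u) := ⟨by simp [h], by simp [h]⟩
  have r1 : W.Reach {i} ({i} ∪ W.post u) := fires_reach .refl f1
  have f2 : W.Fires ({i} ∪ W.post u) u ({i} ∪ W.post u) :=
    ⟨by simp [h], by rw [h]; ext; simp⟩
  have := g.safe _ _ _ r1 f2
  rw [h] at this
  rw [Set.eq_empty_iff_forall_notMem] at this ⊢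
  intro x hx
  exact this x ⟨by simp [hx], hx⟩

lemma Good.ne_o (g : Good W i o) {u : W.T} {p : W.P} (h : p ∈ W.pre u) : p ≠ o := fun e =>
  (g.wf.2.1 p).2 e u h

lemma Good.frame (g : Good W i o) {M1 M2 R : Set W.P} (hr : W.Reach {i} (M1 ∪ R))
    (hd : ∀ p ∈ R, p ∉ M1) (h : W.Reach M1 M2) :
    W.Reach {i} (M2 ∪ R) ∧ ∀ p ∈ R, p ∉ M2 := by
  induction h with
  | refl => exact ⟨hr, hd⟩
  | tail _ hs ih =>
    rename_i b c hbc
    obtain ⟨t, ht, rfl⟩ := hs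
    obtain ⟨r, d⟩ := ih
    have f : W.Fires (b ∪ R) t ((b \ W.pre t ∪ W.post t) ∪ R) := by
      refine ⟨ht.trans Set.subset_union_left, ?_⟩
      ext x
      have h1 := d x
      have h2 := @ht x
      simp only [Set.mem_union, Set.mem_diff]
      tauto
    refine ⟨fires_reach r f, ?_⟩
    intro p hp hp'
    have := g.safe _ _ _ r f
    rw [Set.eq_empty_iff_forall_notMem] at this
    have h1 := d p hp
    have h2 := @ht p
    rcases hp' with hp' | hp'
    · exact h1 hp'.1
    · exact this p ⟨⟨Or.inr hp, fun h => h1 (h2 h)⟩, hp'⟩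

lemma Good.post_nonempty (g : Good W i o) {t : W.T} (h : (W.pre t).Nonempty) :
    (W.post t).Nonempty := by
  by_contra hne
  rw [Set.not_nonempty_iff_eq_empty] at hne
  obtain ⟨M, hM, hsub⟩ := g.sound.2.2 t
  have f : W.Fires M t (M \ W.pre t) := ⟨hsub, by simp [hne]⟩
  have r := fires_reach hM f
  have r2 := g.sound.1 _ r
  have e : (M \ W.pre t) ∪ W.pre t = M := Set.diff_union_of_subset hsub
  obtain ⟨r3, d⟩ := g.frame (M1 := M \ W.pre t) (R := W.pre t) (by rwa [e]) (fun p hp h => h.2 hp) r2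
  have e2 := g.sound.2.1 _ r3 (Or.inl rfl)
  obtain ⟨p, hp⟩ := h
  have : p ∈ ({o} : Set W.P) := by rw [← e2]; exact Or.inr hp
  exact d p hp this

def down (W : PetriNet) (Q : Set W.P) (p : W.P) : Prop := ∃ q ∈ Q, W.causLe (Sum.inl q) (Sum.inl p)

lemma delay (Q : Set W.P) {M1 M : Set W.P} (hQ : Q ⊆ M1) (h : W.Reach M1 M) :
    ∃ M'', W.Reach M1 M'' ∧ Q ⊆ M'' ∧ ∀ p ∈ M, ¬ W.down Q p → p ∈ M'' := by
  induction h with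
  | refl => exact ⟨M1, .refl, hQ, fun p h _ => h⟩
  | tail _ hs ih =>
    rename_i b c hbc
    obtain ⟨t, ht, rfl⟩ := hs
    obtain ⟨M'', r, hq, hp⟩ := ih
    by_cases hd : ∃ p ∈ W.pre t, W.down Q p
    · refine ⟨M'', r, hq, ?_⟩
      rintro p (hp' | hp') hnd
      · exact hp p hp'.1 hnd
      · obtain ⟨p0, hp0, q, hq, hle⟩ := hd
        exact absurd ⟨q, hq, (hle.tail (prec_pre W hp0)).tail (prec_post W hp')⟩ hnd
    · push Not at hd
      refine ⟨M'' \ W.pre t ∪ W.post t, fires_reach r ⟨fun p h => hp p (ht h) (hd p h), rfl⟩, ?_, ?_⟩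
      · intro q hq'
        exact Or.inl ⟨hq hq', fun h => hd q h ⟨q, hq', .refl⟩⟩
      · rintro p (hp' | hp') hnd
        · exact Or.inl ⟨hp p hp'.1 hnd, hp'.2⟩
        · exact Or.inr hp'

lemma consume {M M' : Set W.P} {p : W.P} (hp : p ∈ M) (h : W.Reach M M') (hn : p ∉ M') :
    ∃ M3 t, W.Reach M M3 ∧ W.pre t ⊆ M3 ∧ p ∈ W.pre t := by
  induction h with
  | refl => exact absurd hp hn
  | tail hr hs ih =>
    rename_i b c
    obtain ⟨t, ht, rfl⟩ := hs
    by_cases hb : p ∈ b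
    · refine ⟨b, t, hr, ht, ?_⟩
      by_contra h
      exact hn (Or.inl ⟨hb, h⟩)
    · exact ih hb

lemma Good.once (g : Good W i o) {M M1 M2 : Set W.P} {t s : W.T} {p : W.P}
    (hM : W.Reach {i} M) (hf : W.Fires M t M1) (hr : W.Reach M1 M2)
    (hc : W.SameC (Sum.inr t) (Sum.inr s)) (hp : p ∈ W.pre s) : p ∉ M2 := by
  intro hp2
  have hr1 := fires_reach hM hf
  have ho := g.sound.1 _ (hr1.trans hr)
  obtain ⟨M3, t3, r3, hsub, hp3⟩ := consume hp2 ho (by simpa using g.ne_o hp)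
  have hc3 : W.SameC (Sum.inr t) (Sum.inr t3) := .trans _ _ _ hc (sameC_share W hp hp3)
  have hpost := g.clus _ _ hc3
  obtain ⟨M'', r, hQ, hnd⟩ := delay (W.post t) (by rw [hf.2]; exact Set.subset_union_right)
    (hr.trans r3)
  have hnd3 : ∀ p ∈ W.pre t3, ¬ W.down (W.post t) p := by
    rintro p hp ⟨q, hq, hle⟩
    rw [hpost] at hq
    exact g.loopfree (Sum.inr t3)
      ((Relation.TransGen.head' (prec_post W hq) hle).tail (prec_pre W hp))
  have f3 : W.Fires M'' t3 (M'' \ W.pre t3 ∪ W.post t3) :=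
    ⟨fun p hp => hnd p (hsub hp) (hnd3 p hp), rfl⟩
  have hs := g.safe _ _ _ (hr1.trans r) f3
  obtain ⟨q, hq⟩ := g.post_nonempty ⟨p, hp3⟩
  rw [Set.eq_empty_iff_forall_notMem] at hs
  have hq' : q ∈ W.post t := by rw [hpost]; exact hq
  exact hs q ⟨⟨hQ hq', fun h => hnd3 q h ⟨q, hq', .refl⟩⟩, hq⟩

/-! Dates -/

lemma date_fix (N : PetriNet) (τ : N.T → ℝ≥0∞) (init : N.P → ℝ≥0∞) :
    N.date τ init = N.dateF τ init (N.date τ init) := by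
  have h0 : N.date τ init = ⨆ k, (N.dateF τ init) ((N.dateF τ init)^[k] ⊥) := by
    unfold date
    rw [← sup_iSup_nat_succ]
    simp only [Function.iterate_succ_apply', Function.iterate_zero, id, bot_sup_eq]
  conv_lhs => rw [h0]
  funext x
  rw [iSup_apply]
  rcases x with p | t
  · simp only [dateF, date, iSup_apply]
    split_ifs with h
    · exact ciSup_const
    · rw [iSup_comm]
      congr 1; funext t
      rw [iSup_comm]
  · simp only [dateF, date, iSup_apply]
    rw [← ENNReal.iSup_add]
    congr 1
    rw [iSup_comm]
    congr 1; funext t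
    rw [iSup_comm]

lemma date_tr (N : PetriNet) (τ : N.T → ℝ≥0∞) (init : N.P → ℝ≥0∞) (t : N.T) :
    N.date τ init (Sum.inr t) = (⨆ p ∈ N.pre t, N.date τ init (Sum.inl p)) + τ t := by
  conv_lhs => rw [date_fix]
  rfl

lemma date_min (N : PetriNet) (τ : N.T → ℝ≥0∞) (init : N.P → ℝ≥0∞) (p : N.P) (h : N.Minimal p) :
    N.date τ init (Sum.inl p) = init p := by
  rw [date_fix]
  simp [dateF, h]

lemma date_pl (N : PetriNet) (hN : N.IsOccurrenceNet) (τ : N.T → ℝ≥0∞) (init : N.P → ℝ≥0∞)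
    (p : N.P) (t : N.T) (h : p ∈ N.post t) :
    N.date τ init (Sum.inl p) = N.date τ init (Sum.inr t) := by
  have e : {t : N.T | p ∈ N.post t} = {t} := by
    ext s
    exact ⟨fun hs => hN.2.2.2.1 p hs h, fun hs => by rw [Set.mem_singleton_iff.1 hs]; exact h⟩
  have hm : ¬ N.Minimal p := fun hm => hm t h
  conv_lhs => rw [date_fix]
  simp only [dateF, if_neg hm, e]
  simp

/-! Occurrence net -/

variable {U : PetriNet}

def cut (U : PetriNet) (κ : Set U.Node) : Set U.P :=
  {p | Sum.inl p ∈ κ ∧ ∀ t, Sum.inr t ∈ κ → p ∉ U.pre t}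

def EStep (U : PetriNet) (κ κ' : Set U.Node) : Prop :=
  ∃ t, U.Extends κ t ∧ κ' = κ ∪ {Sum.inr t} ∪ Sum.inl '' U.post t

lemma causLe_pl {x : U.Node} {p : U.P} (h : U.causLe x (Sum.inl p)) :
    x = Sum.inl p ∨ ∃ t, p ∈ U.post t ∧ U.causLe x (Sum.inr t) := by
  rcases Relation.ReflTransGen.cases_tail h with h | ⟨y, h1, h2⟩
  · exact Or.inl h.symm
  · rcases y with q | t
    · exact h2.elim
    · exact Or.inr ⟨t, h2, h1⟩

lemma causLe_tr {x : U.Node} {t : U.T} (h : U.causLe x (Sum.inr t)) :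
    x = Sum.inr t ∨ ∃ p, p ∈ U.pre t ∧ U.causLe x (Sum.inl p) := by
  rcases Relation.ReflTransGen.cases_tail h with h | ⟨y, h1, h2⟩
  · exact Or.inl h.symm
  · rcases y with p | t
    · exact Or.inr ⟨p, h2, h1⟩
    · exact h2.elim

lemma pl_causLe {x : U.Node} {p : U.P} (h : U.causLe (Sum.inl p) x) :
    x = Sum.inl p ∨ ∃ t, p ∈ U.pre t ∧ U.causLe (Sum.inr t) x := by
  rcases Relation.ReflTransGen.cases_head h with h | ⟨y, h1, h2⟩
  · exact Or.inl h.symm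
  · rcases y with q | t
    · exact h1.elim
    · exact Or.inr ⟨t, h1, h2⟩

lemma cut_concurrent {κ : Set U.Node} (hκ : U.IsConfiguration κ) {p q : U.P}
    (hp : p ∈ U.cut κ) (hq : q ∈ U.cut κ) : p = q ∨ U.Concurrent (Sum.inl p) (Sum.inl q) := by
  have key : ∀ p q, p ∈ U.cut κ → q ∈ U.cut κ → p ≠ q → ¬ U.causLe (Sum.inl p) (Sum.inl q) := by
    intro p q hp hq hne h
    rcases pl_causLe h with h | ⟨t, h1, h2⟩
    · exact hne (Sum.inl.inj h).symm
    · exact hp.2 t (hκ.1 _ _ h2 hq.1) h1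
  by_cases e : p = q
  · exact Or.inl e
  · exact Or.inr ⟨key p q hp hq e, key q p hq hp (Ne.symm e), hκ.2 _ hp.1 _ hq.1⟩

lemma pre_concurrent (hU : U.IsOccurrenceNet) (t : U.T) {p q : U.P}
    (hp : p ∈ U.pre t) (hq : q ∈ U.pre t) : p = q ∨ U.Concurrent (Sum.inl p) (Sum.inl q) := by
  have key : ∀ p q, p ∈ U.pre t → q ∈ U.pre t → p ≠ q → ¬ U.causLe (Sum.inl p) (Sum.inl q) := by
    intro p q hp hq hne h
    rcases pl_causLe h with h | ⟨t1, h1, h2⟩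
    · exact hne (Sum.inl.inj h).symm
    · have h3 : U.causLe (Sum.inr t1) (Sum.inr t) := h2.tail (prec_pre U hq)
      by_cases e : t1 = t
      · subst e
        have := hU.2.1 _ _ h2 (.single (prec_pre U hq))
        cases this
      · exact hU.1 (Sum.inr t) ⟨t1, t, e, h3, .refl, p, h1, hp⟩
  by_cases e : p = q
  · exact Or.inl e
  · refine Or.inr ⟨key p q hp hq e, key q p hq hp (Ne.symm e), ?_⟩
    rintro ⟨t1, t2, hne, h1, h2, h3⟩
    exact hU.1 (Sum.inr t) ⟨t1, t2, hne, h1.tail (prec_pre U hp), h2.tail (prec_pre U hq), h3⟩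

lemma extends_of_cut (hU : U.IsOccurrenceNet) {κ : Set U.Node} (hκ : U.IsConfiguration κ) {t : U.T}
    (ht : Sum.inr t ∉ κ) (hp : U.pre t ⊆ U.cut κ) : U.Extends κ t := by
  have htr : ∀ x, U.causLe x (Sum.inr t) → x ∈ κ ∨ x = Sum.inr t := by
    intro x h
    rcases causLe_tr h with h | ⟨p, h1, h2⟩
    · exact Or.inr h
    · exact Or.inl (hκ.1 _ _ h2 (hp h1).1)
  have hcl : ∀ x y : U.Node, U.causLe x y → y ∈ κ ∪ {Sum.inr t} ∪ Sum.inl '' U.post t →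
      x ∈ κ ∪ {Sum.inr t} ∪ Sum.inl '' U.post t := by
    rintro x y h ((hy | hy) | ⟨q, hq, rfl⟩)
    · exact Or.inl (Or.inl (hκ.1 _ _ h hy))
    · rw [Set.mem_singleton_iff.1 hy] at h
      exact Or.inl (htr x h)
    · rcases causLe_pl h with rfl | ⟨t1, h1, h2⟩
      · exact Or.inr ⟨q, hq, rfl⟩
      · have e : t1 = t := hU.2.2.2.1 q h1 hq
        subst e
        exact Or.inl (htr x h2)
  have htm : ∀ t1, Sum.inr t1 ∈ κ ∪ {Sum.inr t} ∪ Sum.inl '' U.post t →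
      Sum.inr t1 ∈ κ ∨ t1 = t := by
    rintro t1 ((h | h) | ⟨q, hq, h⟩)
    · exact Or.inl h
    · exact Or.inr (Sum.inr.inj h)
    · cases h
  refine ⟨ht, fun p h => (hp h).1, hcl, ?_⟩
  rintro x hx y hy ⟨t1, t2, hne, h1, h2, p, hp1, hp2⟩
  rcases htm t1 (hcl _ _ h1 hx) with m1 | rfl <;> rcases htm t2 (hcl _ _ h2 hy) with m2 | rfl
  · exact hκ.2 _ m1 _ m2 ⟨t1, t2, hne, .refl, .refl, p, hp1, hp2⟩
  · exact (hp hp2).2 _ m1 hp1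
  · exact (hp hp1).2 _ m2 hp2
  · exact hne rfl

lemma extends_cut {κ : Set U.Node} {t : U.T} (h : U.Extends κ t) : U.pre t ⊆ U.cut κ := by
  intro p hp
  refine ⟨h.2.1 p hp, fun t1 h1 hp1 => ?_⟩
  have hne : t1 ≠ t := by rintro rfl; exact h.1 h1
  exact h.2.2.2 (Sum.inr t1) (Or.inl (Or.inl h1)) (Sum.inr t) (Or.inl (Or.inr rfl))
    ⟨t1, t, hne, .refl, .refl, p, hp1, hp⟩

lemma cut_step (hU : U.IsOccurrenceNet) {κ : Set U.Node} (hκ : U.IsConfiguration κ) {t : U.T}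
    (h : U.Extends κ t) :
    U.cut (κ ∪ {Sum.inr t} ∪ Sum.inl '' U.post t) = (U.cut κ \ U.pre t) ∪ U.post t := by
  ext p
  constructor
  · rintro ⟨(hp | hp) | ⟨q, hq, e⟩, h2⟩
    · exact Or.inl ⟨⟨hp, fun t1 h1 => h2 t1 (Or.inl (Or.inl h1))⟩, h2 t (Or.inl (Or.inr rfl))⟩
    · cases hp
    · cases e; exact Or.inr hq
  · rintro (⟨hp, hp2⟩ | hp)
    · refine ⟨Or.inl (Or.inl hp.1), ?_⟩
      rintro t1 ((h1 | h1) | ⟨q, hq, e⟩)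
      · exact hp.2 t1 h1
      · rw [Sum.inr.inj h1]; exact hp2
      · cases e
    · refine ⟨Or.inr ⟨p, hp, rfl⟩, ?_⟩
      rintro t1 ((h1 | h1) | ⟨q, hq, e⟩) hp1
      · exact h.1 (hκ.1 _ _ ((Relation.ReflTransGen.single (prec_post U hp)).tail (prec_pre U hp1)) h1)
      · rw [Sum.inr.inj h1] at hp1
        have := hU.2.1 _ _ (.single (prec_post U hp)) (.single (prec_pre U hp1))
        cases this
      · cases e

lemma initConf_config : U.IsConfiguration U.initConf := by
  have hcl : ∀ x y : U.Node, U.causLe x y → y ∈ U.initConf → x ∈ U.initConf := by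
    rintro x y h ⟨p, hp, rfl⟩
    rcases causLe_pl h with rfl | ⟨t, h1, _⟩
    · exact ⟨p, hp, rfl⟩
    · exact absurd h1 (hp t)
  refine ⟨hcl, ?_⟩
  rintro x hx y hy ⟨t1, t2, hne, h1, h2, _⟩
  obtain ⟨p, _, e⟩ := hcl _ _ h1 hx
  cases e

lemma cut_init : U.cut U.initConf = {p | U.Minimal p} := by
  ext p
  constructor
  · rintro ⟨⟨q, hq, e⟩, _⟩
    cases e; exact hq
  · intro hp
    refine ⟨⟨p, hp, rfl⟩, ?_⟩
    rintro t ⟨q, _, e⟩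
    cases e

/-- Invariants of reached configurations. -/
structure Inv (φ : NetMorphism U W) (i : W.P) (κ : Set U.Node) : Prop where
  conf : U.IsConfiguration κ
  inj : Set.InjOn φ.fP (U.cut κ)
  reach : W.Reach {i} (φ.fP '' U.cut κ)
  fired : ∀ s, Sum.inr s ∈ κ → ∃ M M1, W.Reach {i} M ∧ W.Fires M (φ.fT s) M1 ∧
    W.Reach M1 (φ.fP '' U.cut κ)
  uniq : ∀ s1 s2, Sum.inr s1 ∈ κ → Sum.inr s2 ∈ κ →
    W.SameC (Sum.inr (φ.fT s1)) (Sum.inr (φ.fT s2)) →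
    (W.pre (φ.fT s1)).Nonempty → (W.pre (φ.fT s2)).Nonempty → s1 = s2
  init : U.initConf ⊆ κ
  posts : ∀ s, Sum.inr s ∈ κ → ∀ p ∈ U.post s, Sum.inl p ∈ κ

lemma inv_of_reach (g : Good W i o) (φ : NetMorphism U W) (hunf : IsUnfolding U W φ)
    {κ : Set U.Node} (h : Relation.ReflTransGen U.EStep U.initConf κ) : Inv φ i κ := by
  induction h with
  | refl =>
    have hno : ∀ s, Sum.inr s ∉ U.initConf := by
      rintro t ⟨q, _, e⟩
      cases e
    refine ⟨initConf_config, ?_, ?_, fun s h => absurd h (hno s), fun s _ h => absurd h (hno s),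
      le_rfl, fun s h => absurd h (hno s)⟩
    · rw [cut_init]; exact hunf.2.1.injOn
    · rw [cut_init, hunf.2.1.image_eq]
      have : {p : W.P | ∀ t, p ∉ W.post t} = {i} := by ext p; exact g.wf.1 p
      rw [this]
      exact .refl
  | tail _ hs ih =>
    rename_i κ κ2 hbc
    obtain ⟨t, ht, rfl⟩ := hs
    have hcut := cut_step hunf.1 ih.conf ht
    have hpre := extends_cut ht
    have himg : φ.fP '' (U.cut κ \ U.pre t ∪ U.post t) =
        (φ.fP '' U.cut κ) \ W.pre (φ.fT t) ∪ W.post (φ.fT t) := by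
      rw [Set.image_union, ih.inj.image_diff_subset hpre, (φ.pre_bij t).image_eq,
        (φ.post_bij t).image_eq]
    have hf : W.Fires (φ.fP '' U.cut κ) (φ.fT t) (φ.fP '' (U.cut κ \ U.pre t ∪ U.post t)) := by
      refine ⟨?_, himg⟩
      rw [← (φ.pre_bij t).image_eq]
      exact Set.image_mono hpre
    have hsafe := g.safe _ _ _ ih.reach hf
    rw [← (φ.pre_bij t).image_eq, ← ih.inj.image_diff_subset hpre, ← (φ.post_bij t).image_eq,
      Set.eq_empty_iff_forall_notMem] at hsafe
    have hnew : ∀ s1, Sum.inr s1 ∈ κ → W.SameC (Sum.inr (φ.fT s1)) (Sum.inr (φ.fT t)) →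
        ¬ (W.pre (φ.fT t)).Nonempty := by
      rintro s1 h1 hc ⟨p, hp⟩
      obtain ⟨M, M1, a, b, c⟩ := ih.fired s1 h1
      exact g.once a b c hc hp (hf.1 hp)
    have htm : ∀ t1, Sum.inr t1 ∈ κ ∪ {Sum.inr t} ∪ Sum.inl '' U.post t →
        Sum.inr t1 ∈ κ ∨ t1 = t := by
      rintro t1 ((h | h) | ⟨q, hq, h⟩)
      · exact Or.inl h
      · exact Or.inr (Sum.inr.inj h)
      · cases h
    refine ⟨ht.2.2, ?_, ?_, ?_, ?_, ?_, ?_⟩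
    · rw [hcut]
      rintro x (hx | hx) y (hy | hy) e
      · exact ih.inj hx.1 hy.1 e
      · exact absurd ⟨⟨x, hx, rfl⟩, ⟨y, hy, e.symm⟩⟩ (hsafe (φ.fP x))
      · exact absurd ⟨⟨y, hy, rfl⟩, ⟨x, hx, e⟩⟩ (hsafe (φ.fP y))
      · exact (φ.post_bij t).injOn hx hy e
    · rw [hcut]; exact fires_reach ih.reach hf
    · intro s hs
      rw [hcut]
      rcases htm s hs with hs | rfl
      · obtain ⟨M, M1, a, b, c⟩ := ih.fired s hs
        exact ⟨M, M1, a, b, fires_reach c hf⟩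
      · exact ⟨_, _, ih.reach, hf, .refl⟩
    · intro s1 s2 h1 h2 hc n1 n2
      rcases htm s1 h1 with k1 | rfl <;> rcases htm s2 h2 with k2 | rfl
      · exact ih.uniq s1 s2 k1 k2 hc n1 n2
      · exact absurd n2 (hnew s1 k1 hc)
      · exact absurd n1 (hnew s2 k2 (.symm _ _ hc))
      · rfl
    · exact fun x hx => Or.inl (Or.inl (ih.init hx))
    · intro s hs p hp
      rcases htm s hs with hs | rfl
      · exact Or.inl (Or.inl (ih.posts s hs p hp))
      · exact Or.inr ⟨p, hp, rfl⟩

lemma Good.stuck (g : Good W i o) {M M' : Set W.P}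
    (hn : ∀ u, W.pre u ⊆ M → W.pre u = ∅) (h : W.Reach M M') : M' = M := by
  induction h with
  | refl => rfl
  | tail _ hs ih =>
    obtain ⟨t, ht, rfl⟩ := hs
    subst ih
    have h1 := hn t ht
    rw [h1, g.post_empty h1]; simp

lemma final_consumed (g : Good W i o) (φ : NetMorphism U W) (hunf : IsUnfolding U W φ)
    {κ : Set U.Node} (I : Inv φ i κ) (hmax : ∀ t, ¬ U.Extends κ t) {p : U.P}
    (hp : Sum.inl p ∈ κ) (hpo : φ.fP p ≠ o) : ∃ t, Sum.inr t ∈ κ ∧ p ∈ U.pre t := by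
  by_contra hcon
  push Not at hcon
  have hpc : p ∈ U.cut κ := ⟨hp, hcon⟩
  have hst := g.stuck (M := φ.fP '' U.cut κ) (M' := {o}) ?_ (g.sound.1 _ I.reach)
  · have : φ.fP p ∈ ({o} : Set W.P) := by rw [hst]; exact ⟨p, hpc, rfl⟩
    exact hpo this
  · intro u hu
    obtain ⟨X, hX, hb⟩ : ∃ X, X ⊆ U.cut κ ∧ Set.BijOn φ.fP X (W.pre u) := by
      obtain ⟨X, hX, e⟩ := Set.subset_image_iff.1 hu
      exact ⟨X, hX, by rw [← e]; exact (I.inj.mono hX).bijOn_image⟩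
    obtain ⟨t, ⟨h1, h2⟩, _⟩ := hunf.2.2 X u
      (fun p hp q hq => cut_concurrent I.conf (hX hp) (hX hq)) hb
    have htk : Sum.inr t ∈ κ := by
      by_contra h
      exact hmax t (extends_of_cut hunf.1 I.conf h (by rw [h1]; exact hX))
    rw [← hb.image_eq]
    rw [Set.image_eq_empty, Set.eq_empty_iff_forall_notMem]
    intro x hx
    exact (hX hx).2 t htk (by rw [h1]; exact hx)

lemma pre_ne (φ : NetMorphism U W) {t : U.T} {p : U.P} (h : p ∈ U.pre t) :
    φ.fP p ∈ W.pre (φ.fT t) := (φ.pre_bij t).mapsTo h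

/-- matching of a transition given matches of its preset. -/
lemma match_tr (g : Good W i o) (φ : NetMorphism U W) (hunf : IsUnfolding U W φ)
    {κ : Set U.Node} (I : Inv φ i κ) (hmax : ∀ t, ¬ U.Extends κ t) (t : U.T)
    (hne : (U.pre t).Nonempty)
    (hm : ∀ p ∈ U.pre t, ∃ q, Sum.inl q ∈ κ ∧ φ.fP q = φ.fP p) :
    ∃ s, Sum.inr s ∈ κ ∧ W.SameC (Sum.inr (φ.fT t)) (Sum.inr (φ.fT s)) ∧
      W.pre (φ.fT t) ⊆ W.pre (φ.fT s) := by
  have key : ∀ p ∈ U.pre t, ∃ s, Sum.inr s ∈ κ ∧ W.SameC (Sum.inr (φ.fT t)) (Sum.inr (φ.fT s)) ∧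
      φ.fP p ∈ W.pre (φ.fT s) := by
    intro p hp
    obtain ⟨q, hq, e⟩ := hm p hp
    have h1 := pre_ne φ hp
    obtain ⟨s, hs, hqs⟩ := final_consumed g φ hunf I hmax hq (by rw [e]; exact g.ne_o h1)
    have h2 := pre_ne φ hqs
    rw [e] at h2
    exact ⟨s, hs, sameC_share W h1 h2, h2⟩
  obtain ⟨p, hp⟩ := hne
  obtain ⟨s, hs, hc, h⟩ := key p hp
  refine ⟨s, hs, hc, ?_⟩
  rw [← (φ.pre_bij t).image_eq]
  rintro _ ⟨p', hp', rfl⟩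
  obtain ⟨s', hs', hc', h'⟩ := key p' hp'
  have : s' = s := I.uniq s' s hs' hs (.trans _ _ _ (.symm _ _ hc') hc) ⟨_, h'⟩ ⟨_, h⟩
  rwa [← this]

lemma match_pl (g : Good W i o) (φ : NetMorphism U W) (hunf : IsUnfolding U W φ)
    {κ κ' : Set U.Node} (I : Inv φ i κ) (hmax : ∀ t, ¬ U.Extends κ t)
    (h : Relation.ReflTransGen U.EStep U.initConf κ') :
    ∀ p, Sum.inl p ∈ κ' → ∃ q, Sum.inl q ∈ κ ∧ φ.fP q = φ.fP p := by
  induction h with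
  | refl => exact fun p hp => ⟨p, I.init hp, rfl⟩
  | tail _ hs ih =>
    obtain ⟨t, ht, rfl⟩ := hs
    rintro p ((hp | hp) | ⟨p, hp, e⟩)
    · exact ih p hp
    · cases hp
    · cases e
      have hW := (φ.post_bij t).mapsTo hp
      have hne : (U.pre t).Nonempty := by
        by_contra hne
        rw [Set.not_nonempty_iff_eq_empty] at hne
        have h1 : W.pre (φ.fT t) = ∅ := by rw [← (φ.pre_bij t).image_eq, hne, Set.image_empty]
        rw [g.post_empty h1] at hW
        exact hW
      obtain ⟨s, hs, hc, _⟩ := match_tr g φ hunf I hmax t hne (fun p hp => ih p (ht.2.1 p hp))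
      rw [g.clus _ _ hc, ← (φ.post_bij s).image_eq] at hW
      obtain ⟨q, hq, e⟩ := hW
      exact ⟨q, I.posts s hs q hq, e⟩

/-- full matching. -/
lemma match_full (g : Good W i o) (φ : NetMorphism U W) (hunf : IsUnfolding U W φ)
    {κ κ' : Set U.Node}
    (r : Relation.ReflTransGen U.EStep U.initConf κ) (hmax : ∀ t, ¬ U.Extends κ t)
    (r' : Relation.ReflTransGen U.EStep U.initConf κ') (hmax' : ∀ t, ¬ U.Extends κ' t)
    (t : U.T) (ht : Sum.inr t ∈ κ') (hne : (U.pre t).Nonempty) :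
    ∃ s, Sum.inr s ∈ κ ∧ W.pre (φ.fT t) = W.pre (φ.fT s) ∧ W.post (φ.fT t) = W.post (φ.fT s) := by
  have I := inv_of_reach g φ hunf r
  have I' := inv_of_reach g φ hunf r'
  have hin : ∀ {κ : Set U.Node}, Inv φ i κ → ∀ t, Sum.inr t ∈ κ → ∀ p ∈ U.pre t, Sum.inl p ∈ κ :=
    fun I t ht p hp => I.conf.1 _ _ (.single (prec_pre U hp)) ht
  obtain ⟨s, hs, hc, hsub⟩ := match_tr g φ hunf I hmax t hne
    (fun p hp => match_pl g φ hunf I hmax r' p (hin I' t ht p hp))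
  obtain ⟨p, hp⟩ := hne
  have hps := hsub (pre_ne φ hp)
  have hnes : (U.pre s).Nonempty := by
    rw [← (φ.pre_bij s).image_eq] at hps
    obtain ⟨q, hq, _⟩ := hps
    exact ⟨q, hq⟩
  obtain ⟨t2, ht2, hc2, hsub2⟩ := match_tr g φ hunf I' hmax' s hnes
    (fun p hp => match_pl g φ hunf I' hmax' r p (hin I s hs p hp))
  have : t2 = t := I'.uniq t2 t ht2 ht (.symm _ _ (.trans _ _ _ hc hc2)) ⟨_, hsub2 hps⟩
    ⟨_, pre_ne φ hp⟩
  subst this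
  exact ⟨s, hs, hsub.antisymm hsub2, g.clus _ _ hc⟩

lemma race_estep {τ : U.T → ℝ≥0∞} {init : U.P → ℝ≥0∞} {κ : Set U.Node}
    (h : Relation.ReflTransGen (U.RaceStep τ init) U.initConf κ) :
    Relation.ReflTransGen U.EStep U.initConf κ :=
  Relation.ReflTransGen.mono (fun _ _ ⟨t, h1, _, h3⟩ => ⟨t, h1, h3⟩) _ _ h

lemma inj_final (g : Good W i o) (φ : NetMorphism U W) (hunf : IsUnfolding U W φ)
    {κ : Set U.Node} (I : Inv φ i κ) (hmax : ∀ t, ¬ U.Extends κ t) {p q : U.P} {s : U.T}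
    (hs : Sum.inr s ∈ κ) (hp : p ∈ U.pre s) (hq : Sum.inl q ∈ κ) (e : φ.fP q = φ.fP p) :
    q = p := by
  have h1 := pre_ne φ hp
  obtain ⟨s', hs', hq'⟩ := final_consumed g φ hunf I hmax hq (by rw [e]; exact g.ne_o h1)
  have h2 := pre_ne φ hq'
  rw [e] at h2
  have : s' = s := I.uniq s' s hs' hs (sameC_share W h2 h1) ⟨_, h2⟩ ⟨_, h1⟩
  subst this
  exact (φ.pre_bij s').injOn hq' hp e

lemma date_cmp (g : Good W i o) (φ : NetMorphism U W) (hunf : IsUnfolding U W φ)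
    (τ τ' : W.T → ℝ≥0∞) (init init' : U.P → ℝ≥0∞)
    (hτ : ∀ u, τ' u ≤ τ u) (hi : ∀ p, init' p ≤ init p)
    {κ κ' : Set U.Node}
    (r : Relation.ReflTransGen U.EStep U.initConf κ) (hmax : ∀ t, ¬ U.Extends κ t)
    (r' : Relation.ReflTransGen U.EStep U.initConf κ') (hmax' : ∀ t, ¬ U.Extends κ' t)
    {κn : Set U.Node}
    (h : Relation.ReflTransGen (U.RaceStep (fun t => τ' (φ.fT t)) init') U.initConf κn)
    (hsub : κn ⊆ κ') :
    (∀ p, Sum.inl p ∈ κn → ∃ q, Sum.inl q ∈ κ ∧ φ.fP q = φ.fP p ∧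
      U.date (fun t => τ' (φ.fT t)) init' (Sum.inl p) ≤
        U.date (fun t => τ (φ.fT t)) init (Sum.inl q)) ∧
    (∀ t, Sum.inr t ∈ κn → ∃ s, Sum.inr s ∈ κ ∧
      U.date (fun t => τ' (φ.fT t)) init' (Sum.inr t) ≤
        U.date (fun t => τ (φ.fT t)) init (Sum.inr s)) := by
  have I := inv_of_reach g φ hunf r
  induction h with
  | refl =>
    constructor
    · intro p hp
      refine ⟨p, I.init hp, rfl, ?_⟩
      obtain ⟨q, hq, e⟩ := hp
      cases e
      rw [date_min _ _ _ _ hq, date_min _ _ _ _ hq]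
      exact hi p
    · rintro t ⟨q, _, e⟩
      cases e
  | tail hr hs ih =>
    rename_i κn κm
    obtain ⟨t, ht, hmin, rfl⟩ := hs
    obtain ⟨ihp, iht⟩ := ih (fun x hx => hsub (Or.inl (Or.inl hx)))
    have In := inv_of_reach g φ hunf (race_estep hr)
    have htk : Sum.inr t ∈ κ' := hsub (Or.inl (Or.inr rfl))
    have key : ∃ s, Sum.inr s ∈ κ ∧ W.post (φ.fT t) = W.post (φ.fT s) ∧
        U.date (fun t => τ' (φ.fT t)) init' (Sum.inr t) ≤
        U.date (fun t => τ (φ.fT t)) init (Sum.inr s) := by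
      by_cases hne : (U.pre t).Nonempty
      · obtain ⟨s, hs, e1, e2⟩ := match_full g φ hunf r hmax r' hmax' t htk hne
        refine ⟨s, hs, e2, ?_⟩
        obtain ⟨t2, ⟨h1, h2⟩, _⟩ := hunf.2.2 (U.pre t) (φ.fT s)
          (fun p hp q hq => pre_concurrent hunf.1 t hp hq) (by rw [← e1]; exact φ.pre_bij t)
        have hcut := extends_cut ht
        have hx : U.Extends κn t2 := by
          refine extends_of_cut hunf.1 In.conf ?_ (by rw [h1]; exact hcut)
          intro hmem
          obtain ⟨p, hp⟩ := hne
          exact (hcut hp).2 t2 hmem (by rw [h1]; exact hp)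
        refine (hmin t2 hx).trans ?_
        rw [date_tr, date_tr, h1, h2]
        refine add_le_add (iSup₂_le fun p hp => ?_) (hτ _)
        obtain ⟨q, hq, e, hle⟩ := ihp p (ht.2.1 p hp)
        have hW := pre_ne φ hp
        rw [e1, ← (φ.pre_bij s).image_eq] at hW
        obtain ⟨q', hq', e'⟩ := hW
        have : q = q' := inj_final g φ hunf I hmax hs hq' hq (by rw [e, e'])
        subst this
        exact hle.trans (le_iSup₂_of_le q hq' le_rfl)
      · rw [Set.not_nonempty_iff_eq_empty] at hne
        refine ⟨t, ?_, rfl, ?_⟩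
        · by_contra h
          exact hmax t (extends_of_cut hunf.1 I.conf h (by rw [hne]; exact Set.empty_subset _))
        · rw [date_tr, date_tr, hne]
          simpa using hτ _
    obtain ⟨s, hs, hpost, hle⟩ := key
    constructor
    · rintro p ((hp | hp) | ⟨p, hp, e⟩)
      · exact ihp p hp
      · cases hp
      · cases e
        have hW := (φ.post_bij t).mapsTo hp
        rw [hpost, ← (φ.post_bij s).image_eq] at hW
        obtain ⟨q, hq, e⟩ := hW
        refine ⟨q, I.posts s hs q hq, e, ?_⟩
        rw [date_pl U hunf.1 _ _ p t hp, date_pl U hunf.1 _ _ q s hq]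
        exact hle
    · rintro t1 ((h1 | h1) | ⟨p, hp, e⟩)
      · exact iht t1 h1
      · cases h1
        exact ⟨s, hs, hle⟩
      · cases e

end PetriNet

/-- Theorem 2, sufficiency: let `W` be a sound, loop-free, 1-safe
    workflow net and `(U, φ)` its unfolding.  If in every cluster of `W` any two
    distinct transitions have the same postset, then the induced pre-OrchNet on `U`
    (latencies inherited from `W` through `φ`, arbitrary otherwise) is monotonic. -/
theorem stmt12 (W : PetriNet) (i o : W.P)
    (hwf : IsWorkflow W i o) (hsound : IsSound W i o)
    (hsafe : IsSafe W i) (hloopfree : LoopFree W)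
    (U : PetriNet) [Fintype U.P] [Fintype U.T]
    (φ : NetMorphism U W) (hunf : IsUnfolding U W φ)
    (hclus : ∀ c : Set W.Node, W.IsCluster c →
      ∀ t1 t2 : W.T, Sum.inr t1 ∈ c → Sum.inr t2 ∈ c → t1 ≠ t2 → W.post t1 = W.post t2) :
    -- monotony of the induced pre-OrchNet on the unfolding `U`
    ∀ (τ τ' : W.T → ℝ≥0∞) (init init' : U.P → ℝ≥0∞),
      (∀ u, τ' u ≤ τ u) → (∀ p, init' p ≤ init p) →
      ∀ κ κ' : Set U.Node,
        U.Occurs (fun t => τ (φ.fT t)) init κ →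
        U.Occurs (fun t => τ' (φ.fT t)) init' κ' →
        U.execTime (fun t => τ' (φ.fT t)) init' κ' ≤
          U.execTime (fun t => τ (φ.fT t)) init κ := by 
  intro τ τ' init init' hτ hi κ κ' hκ hκ'
  have g : Good W i o := ⟨hwf, hsound, hsafe, hloopfree, fun t1 t2 h => by
    by_cases e : t1 = t2
    · rw [e]
    · exact hclus _ (sameC_cluster W (Sum.inr t1)) t1 t2 (.refl _) h e⟩
  obtain ⟨h1, h2⟩ := date_cmp g φ hunf τ τ' init init' hτ hi (race_estep hκ.1) hκ.2
    (race_estep hκ'.1) hκ'.2 hκ'.1 le_rfl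
  unfold execTime
  refine iSup₂_le fun x hx => ?_
  rcases x with p | t
  · obtain ⟨q, hq, _, hle⟩ := h1 p hx
    exact le_iSup₂_of_le _ hq hle
  · obtain ⟨q, hq, hle⟩ := h2 t hx
    exact le_iSup₂_of_le _ hq hle
end

section
/- Necessity of the cluster condition (Theorem 3): if the workflow net W is sound, the set of allowed latency families is upward closed (W ∈ 𝕎 and W' ≥ W implies W' ∈ 𝕎), and some W* ∈ 𝕎 admits a daemon value ω* making all latencies finite, then violation of the cluster condition (existence of a cluster with two transitions having different postsets) implies that the induced pre-OrchNet ℕ_W is not monotonic. -/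
open scoped ENNReal Classical

open PetriNet

namespace Mono

def Cfg (U : PetriNet) (A : Set U.T) : Prop :=
  (∀ t ∈ A, ∀ t' p, p ∈ U.post t' → p ∈ U.pre t → t' ∈ A) ∧
  (∀ t ∈ A, ∀ t' ∈ A, ∀ p, p ∈ U.pre t → p ∈ U.pre t' → t = t')

def plc (U : PetriNet) (A : Set U.T) : Set U.P := {p | U.Minimal p ∨ ∃ t ∈ A, p ∈ U.post t}

def nodes (U : PetriNet) (A : Set U.T) : Set U.Node := Sum.inl '' plc U A ∪ Sum.inr '' A

def cut (U : PetriNet) (A : Set U.T) : Set U.P := {p | p ∈ plc U A ∧ ∀ t ∈ A, p ∉ U.pre t}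

def Mx (U : PetriNet) (A : Set U.T) : Prop := Cfg U A ∧ ∀ t, t ∉ A → ¬ Cfg U (insert t A)

section basic
variable {U : PetriNet}

@[simp] lemma inl_nodes {A : Set U.T} {p : U.P} : (Sum.inl p : U.Node) ∈ nodes U A ↔ p ∈ plc U A := by
  simp [nodes]
@[simp] lemma inr_nodes {A : Set U.T} {t : U.T} : (Sum.inr t : U.Node) ∈ nodes U A ↔ t ∈ A := by
  simp [nodes]

lemma nodes_empty : nodes U ∅ = U.initConf := by
  simp [nodes, plc, initConf]

lemma nodes_insert (A : Set U.T) (t : U.T) :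
    nodes U A ∪ {Sum.inr t} ∪ Sum.inl '' U.post t = nodes U (insert t A) := by
  ext x
  rcases x with p | s
  · simp [plc, or_assoc, or_comm, or_left_comm]
  · simp

lemma prec_pre {t : U.T} {p : U.P} (h : p ∈ U.pre t) : U.prec (Sum.inl p) (Sum.inr t) := h
lemma prec_post {t : U.T} {p : U.P} (h : p ∈ U.post t) : U.prec (Sum.inr t) (Sum.inl p) := h

lemma closed_of_cfg (hocc : U.IsOccurrenceNet) {A : Set U.T} (hA : Cfg U A) :
    ∀ x y : U.Node, U.causLe x y → y ∈ nodes U A → x ∈ nodes U A := by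
  intro x y h hy
  induction h using Relation.ReflTransGen.head_induction_on with
  | refl => exact hy
  | head hab _ ih =>
    rename_i a c hh
    clear hh
    rcases a with p | t <;> rcases c with q | s
    · exact hab.elim
    · simp at ih ⊢
      by_cases hm : U.Minimal p
      · exact Or.inl hm
      · unfold PetriNet.Minimal at hm
        push Not at hm
        obtain ⟨r, hr⟩ := hm
        exact Or.inr ⟨r, hA.1 s ih r p hr hab, hr⟩
    · simp at ih ⊢
      rcases ih with hm | ⟨r, hr, hq⟩
      · exact (hm t hab).elim
      · have : t = r := hocc.2.2.2.1 q hab hq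
        exact this ▸ hr
    · exact hab.elim

lemma isConf_nodes (hocc : U.IsOccurrenceNet) (A : Set U.T) :
    U.IsConfiguration (nodes U A) ↔ Cfg U A := by
  constructor
  · rintro ⟨h1, h2⟩
    refine ⟨fun t ht t' p h h' => ?_, fun t ht t' ht' p h h' => ?_⟩
    · have : U.causLe (Sum.inr t') (Sum.inr t) :=
        (Relation.ReflTransGen.single (prec_post h)).tail (prec_pre h')
      simpa using h1 _ _ this (by simpa using ht)
    · by_contra hne
      exact h2 (Sum.inr t) (by simpa using ht) (Sum.inr t') (by simpa using ht')
        ⟨t, t', hne, Relation.ReflTransGen.refl, Relation.ReflTransGen.refl, p, h, h'⟩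
  · intro hA
    refine ⟨closed_of_cfg hocc hA, ?_⟩
    rintro x hx y hy ⟨t, t', hne, h1, h2, p, hp, hp'⟩
    have a1 := closed_of_cfg hocc hA _ _ h1 hx
    have a2 := closed_of_cfg hocc hA _ _ h2 hy
    simp at a1 a2
    exact hne (hA.2 t a1 t' a2 p hp hp')

end basic

section acyc
variable {U : PetriNet}

lemma pre_post (hac : LoopFree U) {t : U.T} {p : U.P} (h : p ∈ U.pre t) (h' : p ∈ U.post t) : False :=
  hac (Sum.inl p) ((Relation.TransGen.single (prec_pre h)).tail (prec_post h'))

/-- Preset of an extension lies in the cut. -/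
lemma pre_cut (hac : LoopFree U) {A : Set U.T} {t : U.T} (ht : t ∉ A)
    (h : Cfg U (insert t A)) : U.pre t ⊆ cut U A := by
  intro p hp
  refine ⟨?_, fun s hs hps => ?_⟩
  · by_cases hm : U.Minimal p
    · exact Or.inl hm
    · unfold PetriNet.Minimal at hm
      push Not at hm
      obtain ⟨r, hr⟩ := hm
      rcases h.1 t (Or.inl rfl) r p hr hp with rfl | h1
      · exact (pre_post hac hp hr).elim
      · exact Or.inr ⟨r, h1, hr⟩
  · have := h.2 t (Or.inl rfl) s (Or.inr hs) p hp hps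
    exact ht (this ▸ hs)

lemma cfg_insert (hocc : U.IsOccurrenceNet) {A : Set U.T} {t : U.T} (hA : Cfg U A)
    (h : U.pre t ⊆ cut U A) : Cfg U (insert t A) := by
  refine ⟨?_, ?_⟩
  · rintro s (rfl | hs) t' p h1 h2
    · rcases (h h2).1 with hm | ⟨r, hr, hq⟩
      · exact (hm _ h1).elim
      · have : t' = r := hocc.2.2.2.1 p h1 hq
        exact Or.inr (this ▸ hr)
    · exact Or.inr (hA.1 s hs t' p h1 h2)
  · rintro s (rfl | hs) s' (rfl | hs') p h1 h2
    · rfl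
    · exact ((h h1).2 s' hs' h2).elim
    · exact ((h h2).2 s hs h1).elim
    · exact hA.2 s hs s' hs' p h1 h2

lemma extends_iff (hocc : U.IsOccurrenceNet) (hac : LoopFree U) (A : Set U.T) (t : U.T) :
    U.Extends (nodes U A) t ↔ t ∉ A ∧ Cfg U (insert t A) := by
  unfold PetriNet.Extends
  rw [nodes_insert, isConf_nodes hocc]
  constructor
  · rintro ⟨h1, _, h3⟩
    exact ⟨by simpa using h1, h3⟩
  · rintro ⟨h1, h3⟩
    exact ⟨by simpa using h1, fun p hp => by simpa using (pre_cut hac h1 h3 hp).1, h3⟩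

lemma exists_ext [Fintype U.T] (hac : LoopFree U) {A1 A : Set U.T} (h1 : Cfg U A1) (hA : Cfg U A)
    (hss : A1 ⊆ A) (hne : A1 ≠ A) : ∃ t ∈ A, t ∉ A1 ∧ Cfg U (insert t A1) := by
  let R : U.T → U.T → Prop := fun a b => U.causLt (Sum.inr a) (Sum.inr b)
  haveI : IsTrans U.T R := ⟨fun a b c h h' => Relation.TransGen.trans h h'⟩
  haveI : Std.Irrefl R := ⟨fun a h => hac _ h⟩
  have wf : WellFounded R := Finite.wellFounded_of_trans_of_irrefl R
  have hn : (A \ A1).Nonempty := by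
    rw [Set.diff_nonempty]
    exact fun h => hne (hss.antisymm h)
  obtain ⟨t, ⟨ht, ht1⟩, hmin⟩ := wf.has_min _ hn
  refine ⟨t, ht, ht1, ?_, ?_⟩
  · rintro s (rfl | hs) t' p h2 h3
    · have := hA.1 s ht t' p h2 h3
      by_contra hcon
      exact hmin t' ⟨this, fun h => hcon (Or.inr h)⟩
        ((Relation.TransGen.single (prec_post h2)).tail (prec_pre h3))
    · exact Or.inr (h1.1 s hs t' p h2 h3)
  · intro s hs s' hs'
    have hsub : insert t A1 ⊆ A := Set.insert_subset ht hss
    exact hA.2 s (hsub hs) s' (hsub hs')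

lemma cfg_empty : Cfg U ∅ := ⟨by simp, by simp⟩

lemma cfg_induct [Fintype U.T] (hac : LoopFree U) (P : Set U.T → Prop) (h0 : P ∅)
    {A : Set U.T} (hA : Cfg U A)
    (hs : ∀ B t, B ⊆ A → t ∈ A → Cfg U B → t ∉ B → Cfg U (insert t B) → P B → P (insert t B)) :
    P A := by
  have hfin : {B : Set U.T | B ⊆ A ∧ Cfg U B ∧ P B}.Finite := Set.toFinite _
  obtain ⟨B, hB⟩ := hfin.exists_maximal ⟨∅, Set.empty_subset _, cfg_empty, h0⟩
  obtain ⟨⟨hBA, hB1, hB2⟩, hmax⟩ := hB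
  by_cases he : B = A
  · exact he ▸ hB2
  · obtain ⟨t, ht, htB, hc⟩ := exists_ext hac hB1 hA hBA he
    have := hmax (y := insert t B) ⟨Set.insert_subset ht hBA, hc, hs B t hBA ht hB1 htB hc hB2⟩
      (Set.subset_insert _ _)
    exact (htB (this (Or.inl rfl))).elim

lemma exists_mx [Fintype U.T] {A : Set U.T} (hA : Cfg U A) : ∃ B, A ⊆ B ∧ Mx U B := by
  have hfin : {B : Set U.T | A ⊆ B ∧ Cfg U B}.Finite := Set.toFinite _
  obtain ⟨B, ⟨hAB, hB⟩, hmax⟩ := hfin.exists_maximal ⟨A, subset_rfl, hA⟩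
  refine ⟨B, hAB, hB, fun t ht hc => ht ?_⟩
  exact hmax (y := insert t B) ⟨hAB.trans (Set.subset_insert _ _), hc⟩ (Set.subset_insert _ _)
    (Or.inl rfl)

lemma plc_mono {A B : Set U.T} (h : A ⊆ B) : plc U A ⊆ plc U B := by
  rintro p (hm | ⟨t, ht, hp⟩)
  · exact Or.inl hm
  · exact Or.inr ⟨t, h ht, hp⟩

lemma pre_plc {A : Set U.T} (hA : Cfg U A) {t : U.T} (ht : t ∈ A) : U.pre t ⊆ plc U A := by
  intro p hp
  by_cases hm : U.Minimal p
  · exact Or.inl hm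
  · unfold PetriNet.Minimal at hm
    push Not at hm
    obtain ⟨r, hr⟩ := hm
    exact Or.inr ⟨r, hA.1 t ht r p hr hp, hr⟩

lemma cut_insert (hac : LoopFree U) {A : Set U.T} (hA : Cfg U A) {t : U.T} (ht : t ∉ A)
    (h : Cfg U (insert t A)) : cut U (insert t A) = (cut U A \ U.pre t) ∪ U.post t := by
  ext p
  constructor
  · rintro ⟨h1, h2⟩
    rcases h1 with hm | ⟨s, rfl | hs, hp⟩
    · exact Or.inl ⟨⟨Or.inl hm, fun s hs => h2 s (Or.inr hs)⟩, h2 t (Or.inl rfl)⟩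
    · exact Or.inr hp
    · exact Or.inl ⟨⟨Or.inr ⟨s, hs, hp⟩, fun s hs => h2 s (Or.inr hs)⟩, h2 t (Or.inl rfl)⟩
  · rintro (⟨⟨h1, h2⟩, h3⟩ | hp)
    · refine ⟨plc_mono (Set.subset_insert _ _) h1, ?_⟩
      rintro s (rfl | hs)
      · exact h3
      · exact h2 s hs
    · refine ⟨Or.inr ⟨t, Or.inl rfl, hp⟩, ?_⟩
      rintro s (rfl | hs) hps
      · exact pre_post hac hps hp
      · exact ht (hA.1 s hs t p hp hps)

/-- places of a cut are pairwise concurrent -/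
lemma cut_conc (hocc : U.IsOccurrenceNet) {A : Set U.T} (hA : Cfg U A) {p q : U.P}
    (hp : p ∈ cut U A) (hq : q ∈ cut U A) : p = q ∨ U.Concurrent (Sum.inl p) (Sum.inl q) := by
  by_cases he : p = q
  · exact Or.inl he
  have key : ∀ p q : U.P, p ≠ q → p ∈ cut U A → q ∈ cut U A →
      ¬ U.causLe (Sum.inl p) (Sum.inl q) := by
    intro p q hne hp hq h
    rcases Relation.ReflTransGen.cases_head h with h | ⟨x, hx, hxq⟩
    · exact hne (by simpa using h)
    · rcases x with r | t
      · exact hx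
      · have := closed_of_cfg hocc hA _ _ hxq (by simpa using hq.1)
        simp at this
        exact hp.2 t this hx
  refine Or.inr ⟨key p q he hp hq, key q p (Ne.symm he) hq hp, ?_⟩
  exact ((isConf_nodes hocc A).2 hA).2 _ (by simpa using hp.1) _ (by simpa using hq.1)

end acyc

section morph
variable {U W : PetriNet} {i o : W.P}

lemma loopFree_lift (φ : NetMorphism U W) {x y : U.Node} (h : U.causLt x y) :
    W.causLt (φ.node x) (φ.node y) := by
  refine Relation.TransGen.lift φ.node ?_ _ _ h
  intro a b hab
  rcases a with p | t <;> rcases b with q | s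
  · exact hab.elim
  · exact (φ.pre_bij s).mapsTo hab
  · exact (φ.post_bij t).mapsTo hab
  · exact hab.elim

lemma loopFree_U (φ : NetMorphism U W) (h : LoopFree W) : LoopFree U :=
  fun x hx => h _ (loopFree_lift φ hx)

structure Ctx (U W : PetriNet) (i o : W.P) (φ : NetMorphism U W) : Prop where
  wf : IsWorkflow W i o
  sound : IsSound W i o
  safe : IsSafe W i
  lf : LoopFree W
  unf : IsUnfolding U W φ

variable {φ : NetMorphism U W}

lemma Ctx.occ (C : Ctx U W i o φ) : U.IsOccurrenceNet := C.unf.1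
lemma Ctx.ac (C : Ctx U W i o φ) : LoopFree U := loopFree_U φ C.lf

lemma Ctx.cut_empty (C : Ctx U W i o φ) : φ.fP '' cut U ∅ = {i} ∧ Set.InjOn φ.fP (cut U ∅) := by
  have h := C.unf.2.1
  have e : cut U ∅ = {p : U.P | U.Minimal p} := by
    ext p; simp [cut, plc]
  have e2 : {p : W.P | ∀ t : W.T, p ∉ W.post t} = {i} := by
    ext p; exact C.wf.1 p
  rw [e, ← e2]
  exact ⟨h.image_eq, h.injOn⟩

lemma Ctx.fire (C : Ctx U W i o φ) {A : Set U.T} {t : U.T} (hA : Cfg U A) (ht : t ∉ A)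
    (h : Cfg U (insert t A)) (hinj : Set.InjOn φ.fP (cut U A)) :
    W.Fires (φ.fP '' cut U A) (φ.fT t) (φ.fP '' cut U (insert t A)) := by
  have hp := pre_cut C.ac ht h
  refine ⟨?_, ?_⟩
  · rw [← (φ.pre_bij t).image_eq]
    exact Set.image_mono hp
  · rw [cut_insert C.ac hA ht h, Set.image_union, (φ.post_bij t).image_eq,
      ← (φ.pre_bij t).image_eq, hinj.image_diff_subset hp]

lemma Ctx.cut_inv [Fintype U.T] (C : Ctx U W i o φ) {A : Set U.T} (hA : Cfg U A) :
    W.Reach {i} (φ.fP '' cut U A) ∧ Set.InjOn φ.fP (cut U A) := by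
  refine cfg_induct C.ac (fun A => W.Reach {i} (φ.fP '' cut U A) ∧ Set.InjOn φ.fP (cut U A))
    ?_ hA ?_
  · rw [C.cut_empty.1]
    exact ⟨Relation.ReflTransGen.refl, C.cut_empty.2⟩
  · rintro B t _ _ hB ht hc ⟨h1, h2⟩
    have hf := C.fire hB ht hc h2
    refine ⟨h1.tail ⟨_, hf⟩, ?_⟩
    have hs := C.safe _ _ _ h1 hf
    rw [← (φ.pre_bij t).image_eq, ← (φ.post_bij t).image_eq,
      ← h2.image_diff_subset (pre_cut C.ac ht hc)] at hs
    rw [cut_insert C.ac hB ht hc]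
    have key : ∀ p ∈ cut U B \ U.pre t, ∀ q ∈ U.post t, φ.fP p ≠ φ.fP q := by
      intro p hp q hq he
      have : φ.fP p ∈ φ.fP '' (cut U B \ U.pre t) ∩ φ.fP '' U.post t :=
        ⟨⟨p, hp, rfl⟩, ⟨q, hq, he.symm⟩⟩
      rw [hs] at this
      exact this
    rintro p (hp | hp) q (hq | hq) he
    · exact h2 hp.1 hq.1 he
    · exact (key p hp q hq he).elim
    · exact (key q hq p hp he.symm).elim
    · exact (φ.post_bij t).injOn hp hq he

lemma Ctx.plc_inj [Fintype U.T] (C : Ctx U W i o φ) {A : Set U.T} (hA : Cfg U A) :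
    Set.InjOn φ.fP (plc U A) := by
  intro p hp q hq he
  let A' : Set U.T := {t | t ∈ A ∧ ¬ U.causLt (Sum.inl p) (Sum.inr t) ∧
    ¬ U.causLt (Sum.inl q) (Sum.inr t)}
  have hA' : Cfg U A' := by
    refine ⟨?_, fun t ht t' ht' => hA.2 t ht.1 t' ht'.1⟩
    rintro t ⟨ht, h1, h2⟩ t' r hr hr'
    exact ⟨hA.1 t ht t' r hr hr', fun h => h1 ((h.tail (prec_post hr)).tail (prec_pre hr')),
      fun h => h2 ((h.tail (prec_post hr)).tail (prec_pre hr'))⟩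
  have nl : ∀ a b : U.P, φ.fP a = φ.fP b → ¬ U.causLt (Sum.inl a) (Sum.inl b) := by
    intro a b hab h
    have := loopFree_lift φ h
    simp only [NetMorphism.node, Sum.map_inl] at this
    rw [hab] at this
    exact C.lf _ this
  have pp : p ∈ cut U A' := by
    refine ⟨?_, fun t ht hpt => ht.2.1 (Relation.TransGen.single (prec_pre hpt))⟩
    rcases hp with hm | ⟨t, ht, hpt⟩
    · exact Or.inl hm
    · exact Or.inr ⟨t, ⟨ht, fun h => nl p p rfl (h.tail (prec_post hpt)),
        fun h => nl q p he.symm (h.tail (prec_post hpt))⟩, hpt⟩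
  have qq : q ∈ cut U A' := by
    refine ⟨?_, fun t ht hpt => ht.2.2 (Relation.TransGen.single (prec_pre hpt))⟩
    rcases hq with hm | ⟨t, ht, hpt⟩
    · exact Or.inl hm
    · exact Or.inr ⟨t, ⟨ht, fun h => nl p q he (h.tail (prec_post hpt)),
        fun h => nl q q rfl (h.tail (prec_post hpt))⟩, hpt⟩
  exact (C.cut_inv hA').2 pp qq he

/-- An extension of a sub-configuration which is not in `A` has a fresh label. -/
lemma Ctx.fresh [Fintype U.T] (C : Ctx U W i o φ) {A A1 : Set U.T} (hA : Cfg U A) (h1 : Cfg U A1)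
    (hss : A1 ⊆ A) {s : U.T} (hs : s ∉ A) (hc : Cfg U (insert s A1)) : φ.fT s ∉ φ.fT '' A := by
  rintro ⟨t, ht, he⟩
  have hcut := pre_cut C.ac (fun h => hs (hss h)) hc
  have e : U.pre t = U.pre s := by
    have i1 := (φ.pre_bij t).image_eq
    rw [he, ← (φ.pre_bij s).image_eq] at i1
    exact ((C.plc_inj hA).image_eq_image_iff (pre_plc hA ht)
      (fun p hp => plc_mono hss (hcut hp).1)).1 i1
  obtain ⟨r, _, hr⟩ := C.unf.2.2 (U.pre s) (φ.fT s)
    (fun p hp q hq => cut_conc C.occ h1 (hcut hp) (hcut hq)) (φ.pre_bij s)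
  have := (hr t ⟨e, he⟩).trans (hr s ⟨rfl, rfl⟩).symm
  exact hs (this ▸ ht)

lemma Ctx.exists_lift [Fintype U.T] (C : Ctx U W i o φ) {A : Set U.T} (hA : Cfg U A) {u : W.T}
    (h : W.pre u ⊆ φ.fP '' cut U A) :
    ∃ t, φ.fT t = u ∧ U.pre t ⊆ cut U A ∧ Cfg U (insert t A) := by
  have hinj := (C.cut_inv hA).2
  let X : Set U.P := {p | p ∈ cut U A ∧ φ.fP p ∈ W.pre u}
  obtain ⟨t, ⟨h1, h2⟩, _⟩ := C.unf.2.2 X u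
    (fun p hp q hq => cut_conc C.occ hA hp.1 hq.1)
    ⟨fun p hp => hp.2, hinj.mono fun p hp => hp.1, fun q hq => by
      obtain ⟨p, hp, rfl⟩ := h hq
      exact ⟨p, ⟨hp, hq⟩, rfl⟩⟩
  have hsub : U.pre t ⊆ cut U A := by rw [h1]; exact fun p hp => hp.1
  exact ⟨t, h2, hsub, cfg_insert C.occ hA hsub⟩

lemma Ctx.iso (C : Ctx U W i o φ) {u : W.T} (h : W.pre u = ∅) : W.post u = ∅ := by
  have hr : W.Reach {i} {o} := C.sound.1 _ Relation.ReflTransGen.refl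
  have hf : W.Fires {o} u (({o} \ W.pre u) ∪ W.post u) := ⟨by simp [h], rfl⟩
  have h1 := C.sound.2.1 _ (hr.tail ⟨_, hf⟩) (by simp [h])
  have h2 := C.safe _ _ _ hr hf
  rw [h] at h1 h2
  ext q
  simp only [Set.mem_empty_iff_false, iff_false]
  intro hq
  have : q ∈ ({o} : Set W.P) := h1 ▸ Or.inr hq
  simp only [Set.mem_singleton_iff] at this
  subst this
  have : q ∈ (({q} : Set W.P) \ ∅) ∩ W.post u := ⟨by simp, hq⟩
  rw [h2] at this
  exact this

lemma Ctx.lift_notMem {A : Set U.T} {t : U.T} (hne : (W.pre (φ.fT t)).Nonempty)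
    (h : U.pre t ⊆ cut U A) : t ∉ A := by
  intro ht
  obtain ⟨q, hq⟩ := hne
  rw [← (φ.pre_bij t).image_eq] at hq
  obtain ⟨p, hp, _⟩ := hq
  exact (h hp).2 t ht hp

lemma Ctx.mx_cut [Fintype U.T] (C : Ctx U W i o φ) {A : Set U.T} (hA : Mx U A) :
    φ.fP '' cut U A = {o} := by
  have hr := C.sound.1 _ (C.cut_inv hA.1).1
  suffices ∀ M, W.Reach (φ.fP '' cut U A) M → M = φ.fP '' cut U A from (this _ hr).symm
  intro M h
  induction h with
  | refl => rfl
  | tail _ hst ih =>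
    obtain ⟨u, hu, he⟩ := hst
    subst ih
    obtain ⟨t, rfl, ht1, ht2⟩ := C.exists_lift hA.1 hu
    have h0 : W.pre (φ.fT t) = ∅ := by
      by_contra hne
      exact hA.2 t (Ctx.lift_notMem (Set.nonempty_iff_ne_empty.2 hne) ht1) ht2
    rw [he, h0, C.iso h0]
    simp

/-! Balance -/

lemma Ctx.plc_label (C : Ctx U W i o φ) {A : Set U.T} (q : W.P) :
    q ∈ φ.fP '' plc U A ↔ q = i ∨ ∃ v ∈ φ.fT '' A, q ∈ W.post v := by
  constructor
  · rintro ⟨p, hm | ⟨t, ht, hp⟩, rfl⟩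
    · exact Or.inl ((C.wf.1 _).1 (C.unf.2.1.mapsTo hm))
    · exact Or.inr ⟨_, ⟨t, ht, rfl⟩, (φ.post_bij t).mapsTo hp⟩
  · rintro (rfl | ⟨_, ⟨t, ht, rfl⟩, hq⟩)
    · obtain ⟨p, hp, he⟩ := C.unf.2.1.surjOn ((C.wf.1 q).2 rfl)
      exact ⟨p, Or.inl hp, he⟩
    · obtain ⟨p, hp, he⟩ := (φ.post_bij t).surjOn hq
      exact ⟨p, Or.inr ⟨t, ht, hp⟩, he⟩

lemma Ctx.pre_label {A : Set U.T} (hA : Cfg U A) {v : W.T} (hv : v ∈ φ.fT '' A) {q : W.P}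
    (hq : q ∈ W.pre v) : q ∈ φ.fP '' plc U A := by
  obtain ⟨t, ht, rfl⟩ := hv
  obtain ⟨p, hp, he⟩ := (φ.pre_bij t).surjOn hq
  exact ⟨p, pre_plc hA ht hp, he⟩

lemma Ctx.consumed [Fintype U.T] (C : Ctx U W i o φ) {A : Set U.T} (hA : Mx U A) {q : W.P}
    (hq : q ∈ φ.fP '' plc U A) (ho : q ≠ o) : ∃ v ∈ φ.fT '' A, q ∈ W.pre v := by
  obtain ⟨p, hp, rfl⟩ := hq
  by_contra hcon
  have : p ∈ cut U A := ⟨hp, fun t ht hpt => hcon ⟨_, ⟨t, ht, rfl⟩, (φ.pre_bij t).mapsTo hpt⟩⟩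
  have : φ.fP p ∈ φ.fP '' cut U A := ⟨p, this, rfl⟩
  rw [C.mx_cut hA] at this
  exact ho this

lemma Ctx.pre_uniq [Fintype U.T] (C : Ctx U W i o φ) {A : Set U.T} (hA : Cfg U A) {q : W.P}
    {v v' : W.T} (hv : v ∈ φ.fT '' A) (hv' : v' ∈ φ.fT '' A) (h : q ∈ W.pre v)
    (h' : q ∈ W.pre v') : v = v' := by
  obtain ⟨t, ht, rfl⟩ := hv
  obtain ⟨t', ht', rfl⟩ := hv'
  obtain ⟨p, hp, rfl⟩ := (φ.pre_bij t).surjOn h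
  obtain ⟨p', hp', he⟩ := (φ.pre_bij t').surjOn h'
  have := C.plc_inj hA (pre_plc hA ht' hp') (pre_plc hA ht hp) he
  subst this
  rw [hA.2 t ht t' ht' _ hp hp']

lemma Ctx.post_uniq [Fintype U.T] (C : Ctx U W i o φ) {A : Set U.T} (hA : Cfg U A) {q : W.P}
    {v v' : W.T} (hv : v ∈ φ.fT '' A) (hv' : v' ∈ φ.fT '' A) (h : q ∈ W.post v)
    (h' : q ∈ W.post v') : v = v' := by
  obtain ⟨t, ht, rfl⟩ := hv
  obtain ⟨t', ht', rfl⟩ := hv'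
  obtain ⟨p, hp, rfl⟩ := (φ.post_bij t).surjOn h
  obtain ⟨p', hp', he⟩ := (φ.post_bij t').surjOn h'
  have := C.plc_inj hA (Or.inr ⟨t', ht', hp'⟩) (Or.inr ⟨t, ht, hp⟩) he
  subst this
  rw [C.occ.2.2.2.1 p' hp hp']

lemma Ctx.swap_sub [Fintype U.T] (C : Ctx U W i o φ) {A A' : Set U.T} (hA : Mx U A) (hA' : Mx U A')
    {u u' : W.T} (hu : u ∈ φ.fT '' A)
    (hs : ∀ v, v ≠ u → v ∈ φ.fT '' A → v ∈ φ.fT '' A')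
    (hs' : ∀ v, v ≠ u' → v ∈ φ.fT '' A' → v ∈ φ.fT '' A ∧ v ≠ u) :
    W.pre u ⊆ W.pre u' ∧ W.post u ⊆ W.post u' := by
  constructor
  · intro q hq
    by_contra hq'
    have h1 := Ctx.pre_label hA.1 hu hq
    have hqo : q ≠ o := fun h => (C.wf.2.1 q).2 h u hq
    have h2 : q ∉ φ.fP '' plc U A' := by
      intro h
      obtain ⟨v, hv, hqv⟩ := C.consumed hA' h hqo
      have hvu : v ≠ u' := fun e => hq' (e ▸ hqv)
      obtain ⟨a, b⟩ := hs' v hvu hv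
      exact b (C.pre_uniq hA.1 a hu hqv hq)
    rw [C.plc_label] at h1 h2
    push Not at h2
    rcases h1 with h1 | ⟨v, hv, hqv⟩
    · exact h2.1 h1
    · have : v ≠ u := by
        rintro rfl
        exact pre_post C.lf hq hqv
      exact h2.2 v (hs v this hv) hqv
  · intro q hq
    by_contra hq'
    have h1 : q ∈ φ.fP '' plc U A := (C.plc_label q).2 (Or.inr ⟨u, hu, hq⟩)
    have hqi : q ≠ i := fun h => (C.wf.1 q).2 h u hq
    have h2 : q ∉ φ.fP '' plc U A' := by
      rw [C.plc_label]
      rintro (h | ⟨v, hv, hqv⟩)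
      · exact hqi h
      · have hvu : v ≠ u' := fun e => hq' (e ▸ hqv)
        obtain ⟨a, b⟩ := hs' v hvu hv
        exact b (C.post_uniq hA.1 a hu hqv hq)
    have hqo : q ≠ o := by
      rintro rfl
      have : q ∈ φ.fP '' cut U A' := by rw [C.mx_cut hA']; rfl
      exact h2 (Set.image_mono (fun p hp => hp.1) this)
    obtain ⟨v, hv, hqv⟩ := C.consumed hA h1 hqo
    have : v ≠ u := by
      rintro rfl
      exact pre_post C.lf hqv hq
    exact h2 (Ctx.pre_label hA'.1 (hs v this hv) hqv)

/-! W-level sequences -/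

inductive Sq (W : PetriNet) : Set W.P → Set W.T → Set W.P → Prop
  | nil (M) : Sq W M ∅ M
  | cons {M u M1 L M2} : W.Fires M u M1 → Sq W M1 L M2 → Sq W M (insert u L) M2

lemma sq_of_reach {M M' : Set W.P} (h : W.Reach M M') : ∃ L, Sq W M L M' := by
  induction h using Relation.ReflTransGen.head_induction_on with
  | refl => exact ⟨_, Sq.nil _⟩
  | head hab _ ih =>
    obtain ⟨u, hu⟩ := hab
    obtain ⟨L, hL⟩ := ih
    exact ⟨_, Sq.cons hu hL⟩

lemma sq_snoc {M M' M'' : Set W.P} {L : Set W.T} {u : W.T} (h : Sq W M L M')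
    (hf : W.Fires M' u M'') : Sq W M (insert u L) M'' := by
  induction h with
  | nil => exact Sq.cons hf (Sq.nil _)
  | cons hf' _ ih =>
    rw [Set.insert_comm]
    exact Sq.cons hf' (ih hf)

lemma Ctx.lift_sq [Fintype U.T] (C : Ctx U W i o φ) {M M' : Set W.P} {L : Set W.T}
    (h : Sq W M L M') : ∀ A, Cfg U A → φ.fP '' cut U A = M →
      ∃ A', A ⊆ A' ∧ Cfg U A' ∧ φ.fP '' cut U A' = M' ∧ L ⊆ φ.fT '' A' := by
  induction h with
  | nil => exact fun A hA he => ⟨A, subset_rfl, hA, he, by simp⟩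
  | cons hf _ ih =>
    rename_i M u M1 L M2 _
    intro A hA he
    subst he
    obtain ⟨t, rfl, ht, hc⟩ := C.exists_lift hA hf.1
    have e1 : φ.fP '' cut U (insert t A) = M1 := by
      by_cases htA : t ∈ A
      · have h0 : W.pre (φ.fT t) = ∅ := by
          by_contra hne
          exact Ctx.lift_notMem (Set.nonempty_iff_ne_empty.2 hne) ht htA
        rw [Set.insert_eq_of_mem htA, hf.2, h0, C.iso h0]
        simp
      · rw [hf.2, (C.fire hA htA hc (C.cut_inv hA).2).2]
    obtain ⟨A', h1, h2, h3, h4⟩ := ih _ hc e1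
    refine ⟨A', (Set.subset_insert _ _).trans h1, h2, h3, ?_⟩
    exact Set.insert_subset ⟨t, h1 (Or.inl rfl), rfl⟩ h4

def Eqv (W : PetriNet) (u v : W.T) : Prop := W.pre u = W.pre v ∧ W.post u = W.post v

/-- All dynamic conflicts are between equivalent transitions. -/
def Star (W : PetriNet) (i : W.P) : Prop :=
  ∀ M u v, W.Reach {i} M → W.pre u ⊆ M → W.pre v ⊆ M → (W.pre u ∩ W.pre v).Nonempty → Eqv W u v

lemma Ctx.commute (C : Ctx U W i o φ) (hst : Star W i) {M M' : Set W.P} {L : Set W.T} {u : W.T}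
    (h : Sq W M L M') (hM' : M' = {o}) (hr : W.Reach {i} M) (hu : W.pre u ⊆ M)
    (hne : (W.pre u).Nonempty) :
    ∃ M1 L1, W.Fires M u M1 ∧ Sq W M1 L1 {o} ∧ L1 ⊆ L ∧ ∃ v ∈ L, Eqv W u v := by
  induction h with
  | nil M =>
    subst hM'
    obtain ⟨q, hq⟩ := hne
    exact ((C.wf.2.1 q).2 (hu hq) u hq).elim
  | cons hf hsq ih =>
    rename_i M w M1 L M2
    subst hM'
    by_cases hd : (W.pre u ∩ W.pre w).Nonempty
    · have he := hst M u w hr hu hf.1 hd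
      refine ⟨M1, L, ⟨hu, ?_⟩, hsq, Set.subset_insert _ _, w, Or.inl rfl, he⟩
      rw [hf.2, he.1, he.2]
    · have hd' : ∀ q, q ∈ W.pre u → q ∉ W.pre w := fun q h h' => hd ⟨q, h, h'⟩
      have hu1 : W.pre u ⊆ M1 := by
        intro q hq
        rw [hf.2]
        exact Or.inl ⟨hu hq, hd' q hq⟩
      obtain ⟨M3, L1, h1, h2, h3, v, hv, hve⟩ := ih rfl (hr.tail ⟨w, hf⟩) hu1
      have hfu : W.Fires M u ((M \ W.pre u) ∪ W.post u) := ⟨hu, rfl⟩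
      have s1 := C.safe _ _ _ hr hf
      have s2 := C.safe _ _ _ hr hfu
      have s1' : ∀ q, q ∈ W.pre u → q ∉ W.post w := by
        intro q h h'
        have : q ∈ (M \ W.pre w) ∩ W.post w := ⟨⟨hu h, hd' q h⟩, h'⟩
        rw [s1] at this
        exact this
      have s2' : ∀ q, q ∈ W.pre w → q ∉ W.post u := by
        intro q h h'
        have : q ∈ (M \ W.pre u) ∩ W.post u := ⟨⟨hf.1 h, fun h2 => hd' q h2 h⟩, h'⟩
        rw [s2] at this
        exact this
      refine ⟨_, insert w L1, hfu, Sq.cons (M1 := M3) ⟨?_, ?_⟩ h2, Set.insert_subset_insert h3,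
        v, Or.inr hv, hve⟩
      · intro q hq
        exact Or.inl ⟨hf.1 hq, fun h2 => hd' q h2 hq⟩
      · rw [h1.2, hf.2]
        ext q
        have a1 := s1' q
        have a2 := s2' q
        simp only [Set.mem_union, Set.mem_diff]
        tauto

lemma Ctx.classes (C : Ctx U W i o φ) (hst : Star W i) {M M' : Set W.P} {L' : Set W.T}
    (h : Sq W M L' M') (hr : W.Reach {i} M) : ∀ L, Sq W M L {o} →
      ∀ u ∈ L', (W.pre u).Nonempty → ∃ v ∈ L, Eqv W u v := by
  induction h with
  | nil => simp
  | cons hf hsq ih =>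
    rename_i M w M1 L' M2
    intro L hL u hu hne
    by_cases h0 : W.pre w = ∅
    · have : M1 = M := by rw [hf.2, h0, C.iso h0]; simp
      subst this
      rcases hu with rfl | hu
      · rw [h0] at hne
        exact (Set.not_nonempty_empty hne).elim
      · exact ih hr L hL u hu hne
    · obtain ⟨M3, L1, h1, h2, h3, v, hv, hve⟩ :=
        C.commute hst hL rfl hr hf.1 (Set.nonempty_iff_ne_empty.2 h0)
      rcases hu with rfl | hu
      · exact ⟨v, hv, hve⟩
      · have : M3 = M1 := by rw [h1.2, hf.2]
        subst this
        obtain ⟨v', hv', hve'⟩ := ih (hr.tail ⟨w, hf⟩) L1 h2 u hu hne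
        exact ⟨v', h3 hv', hve'⟩

lemma Ctx.star_static [Fintype U.T] (C : Ctx U W i o φ) (hst : Star W i) {u u' : W.T} {q : W.P}
    (h : q ∈ W.pre u) (h' : q ∈ W.pre u') : W.post u = W.post u' := by
  obtain ⟨L, hL⟩ := sq_of_reach (C.sound.1 _ Relation.ReflTransGen.refl)
  have key : ∀ u, q ∈ W.pre u → ∃ v ∈ L, Eqv W u v := by
    intro u hu
    obtain ⟨M, hM, hp⟩ := C.sound.2.2 u
    obtain ⟨L', hL'⟩ := sq_of_reach hM
    have := sq_snoc hL' (u := u) ⟨hp, rfl⟩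
    exact C.classes hst this Relation.ReflTransGen.refl L hL u (Or.inl rfl) ⟨q, hu⟩
  obtain ⟨v, hv, e⟩ := key u h
  obtain ⟨v', hv', e'⟩ := key u' h'
  obtain ⟨A, _, hA, _, hLA⟩ := C.lift_sq hL ∅ cfg_empty C.cut_empty.1
  have : v = v' := C.pre_uniq hA (hLA hv) (hLA hv') (e.1 ▸ h) (e'.1 ▸ h')
  rw [e.2, e'.2, this]

lemma cluster_viol (hviol : ∃ c : Set W.Node, W.IsCluster c ∧
      ∃ t1 t2 : W.T, Sum.inr t1 ∈ c ∧ Sum.inr t2 ∈ c ∧ t1 ≠ t2 ∧ W.post t1 ≠ W.post t2) :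
    ∃ u u' q, q ∈ W.pre u ∧ q ∈ W.pre u' ∧ W.post u ≠ W.post u' := by
  obtain ⟨c, ⟨_, hcl, hmin⟩, t1, t2, h1, h2, _, hpost⟩ := hviol
  by_contra hcon
  push Not at hcon
  let c' : Set W.Node := {x | x ∈ c ∧ ((∃ t, x = Sum.inr t ∧ W.post t = W.post t1) ∨
    (∃ p, x = Sum.inl p ∧ ∃ t, p ∈ W.pre t ∧ W.post t = W.post t1))}
  have := hmin c' ⟨Sum.inr t1, h1, Or.inl ⟨t1, rfl, rfl⟩⟩ ⟨?_, ?_⟩ (fun x hx => hx.1)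
  · have h2' : Sum.inr t2 ∈ c' := this ▸ h2
    obtain ⟨_, ⟨t, ht, hp⟩ | ⟨p, hp, _⟩⟩ := h2'
    · cases ht
      exact hpost hp.symm
    · cases hp
  · rintro t ⟨ht, ⟨s, hs, hp⟩ | ⟨p, hp, _⟩⟩ p hpt
    · cases hs
      exact ⟨hcl.1 t ht p hpt, Or.inr ⟨p, rfl, t, hpt, hp⟩⟩
    · cases hp
  · rintro p ⟨hp, ⟨s, hs, _⟩ | ⟨p', hp', t, hpt, hpost⟩⟩ s hps
    · cases hs
    · cases hp'
      exact ⟨hcl.2 p hp s hps, Or.inl ⟨s, rfl, (hcon s t p hps hpt).trans hpost⟩⟩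

end morph

section timed
variable {U : PetriNet}

lemma dateF_mono (τ : U.T → ℝ≥0∞) (ι : U.P → ℝ≥0∞) : Monotone (U.dateF τ ι) := by
  intro f g h x
  rcases x with p | t
  · simp only [PetriNet.dateF]
    split_ifs
    · exact le_rfl
    · exact iSup₂_mono fun t _ => h _
  · simp only [PetriNet.dateF]
    exact add_le_add (iSup₂_mono fun p _ => h _) le_rfl

lemma date_le (τ : U.T → ℝ≥0∞) (ι : U.P → ℝ≥0∞) : U.date τ ι ≤ U.dateF τ ι (U.date τ ι) := by
  refine iSup_le fun k => ?_
  cases k with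
  | zero => exact bot_le
  | succ k =>
    rw [Function.iterate_succ_apply']
    exact dateF_mono τ ι (le_iSup (fun k => (U.dateF τ ι)^[k] ⊥) k)

lemma le_date (τ : U.T → ℝ≥0∞) (ι : U.P → ℝ≥0∞) (t : U.T) : τ t ≤ U.date τ ι (Sum.inr t) := by
  have h : (U.dateF τ ι)^[1] ⊥ ≤ U.date τ ι := le_iSup (fun k => (U.dateF τ ι)^[k] ⊥) 1
  refine le_trans ?_ (h (Sum.inr t))
  simp [PetriNet.dateF]

lemma date_bound [Fintype U.P] [Fintype U.T] (hocc : U.IsOccurrenceNet) (hac : LoopFree U)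
    {A : Set U.T} (hA : Cfg U A)
    (τ0 : U.T → ℝ≥0∞) (ι : U.P → ℝ≥0∞) (hτ : ∀ s ∈ A, τ0 s < ⊤) (hι : ∀ p, ι p < ⊤) :
    ∃ D < ⊤, ∀ τ : U.T → ℝ≥0∞, (∀ s ∈ A, τ s ≤ τ0 s) → ∀ x ∈ nodes U A, U.date τ ι x ≤ D := by
  refine cfg_induct hac (fun A => ∃ D < ⊤, ∀ τ : U.T → ℝ≥0∞, (∀ s ∈ A, τ s ≤ τ0 s) →
    ∀ x ∈ nodes U A, U.date τ ι x ≤ D) ?_ hA ?_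
  · refine ⟨∑ p, ι p, ENNReal.sum_lt_top.2 fun p _ => hι p, fun τ _ x hx => ?_⟩
    rcases x with p | t
    · have hm : U.Minimal p := by simpa [plc] using hx
      refine (date_le τ ι _).trans ?_
      simp only [PetriNet.dateF, if_pos hm]
      exact Finset.single_le_sum (f := ι) (fun _ _ => bot_le) (Finset.mem_univ p)
    · simp at hx
  · rintro B t hBA htA hB ht hc ⟨D, hD, hb⟩
    refine ⟨D + τ0 t, ENNReal.add_lt_top.2 ⟨hD, hτ t htA⟩, fun τ hle x hx => ?_⟩
    have hb' := hb τ fun s hs => hle s (Or.inr hs)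
    have htd : U.date τ ι (Sum.inr t) ≤ D + τ0 t := by
      refine (date_le τ ι _).trans ?_
      simp only [PetriNet.dateF]
      refine add_le_add (iSup₂_le fun p hp => hb' _ ?_) (hle t (Or.inl rfl))
      simpa using (pre_cut hac ht hc hp).1
    by_cases hxB : x ∈ nodes U B
    · exact (hb' x hxB).trans le_self_add
    · rcases x with p | s
      · simp at hx hxB
        have hnm : ¬ U.Minimal p := fun h => hxB (Or.inl h)
        refine (date_le τ ι _).trans ?_
        simp only [PetriNet.dateF, if_neg hnm]
        refine iSup₂_le fun s hs => ?_
        rcases hx with h | ⟨r, rfl | hr, hp⟩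
        · exact (hnm h).elim
        · have : s = r := hocc.2.2.2.1 p hs hp
          rw [this]; exact htd
        · exact (hxB (Or.inr ⟨r, hr, hp⟩)).elim
      · simp at hx hxB
        rcases hx with rfl | hx
        · exact htd
        · exact (hxB hx).elim

lemma race_step [Fintype U.T] (hocc : U.IsOccurrenceNet) (hac : LoopFree U) {A : Set U.T}
    (τ : U.T → ℝ≥0∞) (ι : U.P → ℝ≥0∞) (h : ∃ t, t ∉ A ∧ Cfg U (insert t A)) :
    ∃ t, t ∉ A ∧ Cfg U (insert t A) ∧
      (∀ s, s ∉ A → Cfg U (insert s A) → U.date τ ι (Sum.inr t) ≤ U.date τ ι (Sum.inr s)) ∧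
      U.RaceStep τ ι (nodes U A) (nodes U (insert t A)) := by
  obtain ⟨t, ⟨h1, h2⟩, h3⟩ := Set.exists_min_image {t | t ∉ A ∧ Cfg U (insert t A)}
    (fun t => U.date τ ι (Sum.inr t)) (Set.toFinite _) h
  refine ⟨t, h1, h2, fun s hs hs' => h3 s ⟨hs, hs'⟩, t, (extends_iff hocc hac A t).2 ⟨h1, h2⟩,
    fun s hs => h3 s ((extends_iff hocc hac A s).1 hs), (nodes_insert A t).symm⟩

lemma race_reach [Fintype U.T] (hocc : U.IsOccurrenceNet) (hac : LoopFree U) {A : Set U.T}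
    (hA : Cfg U A) (τ : U.T → ℝ≥0∞) (ι : U.P → ℝ≥0∞) (D : ℝ≥0∞)
    (hD : ∀ s ∈ A, U.date τ ι (Sum.inr s) ≤ D)
    (hbig : ∀ A1 s, Cfg U A1 → A1 ⊆ A → s ∉ A → Cfg U (insert s A1) →
      D < U.date τ ι (Sum.inr s)) :
    Relation.ReflTransGen (U.RaceStep τ ι) U.initConf (nodes U A) := by
  have hfin : {B : Set U.T | B ⊆ A ∧ Cfg U B ∧
    Relation.ReflTransGen (U.RaceStep τ ι) U.initConf (nodes U B)}.Finite := Set.toFinite _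
  obtain ⟨B, ⟨hBA, hB1, hB2⟩, hmax⟩ := hfin.exists_maximal
    ⟨∅, Set.empty_subset _, cfg_empty, by rw [nodes_empty]⟩
  by_cases he : B = A
  · exact he ▸ hB2
  · obtain ⟨t, ht, htB, hc⟩ := exists_ext hac hB1 hA hBA he
    obtain ⟨s, hs, hsc, hsm, hstep⟩ := race_step hocc hac τ ι ⟨t, htB, hc⟩
    have hsA : s ∈ A := by
      by_contra hsA
      exact absurd ((hsm t htB hc).trans (hD t ht)) (not_le.2 (hbig B s hB1 hBA hsA hsc))
    have := hmax (y := insert s B) ⟨Set.insert_subset hsA hBA, hsc, hB2.tail hstep⟩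
      (Set.subset_insert _ _)
    exact (hs (this (Or.inl rfl))).elim

lemma race_cont [Fintype U.T] (hocc : U.IsOccurrenceNet) (hac : LoopFree U) {A : Set U.T}
    (hA : Cfg U A) (τ : U.T → ℝ≥0∞) (ι : U.P → ℝ≥0∞) :
    ∃ B, A ⊆ B ∧ Mx U B ∧ Relation.ReflTransGen (U.RaceStep τ ι) (nodes U A) (nodes U B) := by
  have hfin : {B : Set U.T | A ⊆ B ∧ Cfg U B ∧
    Relation.ReflTransGen (U.RaceStep τ ι) (nodes U A) (nodes U B)}.Finite := Set.toFinite _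
  obtain ⟨B, ⟨hBA, hB1, hB2⟩, hmax⟩ := hfin.exists_maximal
    ⟨A, subset_rfl, hA, Relation.ReflTransGen.refl⟩
  refine ⟨B, hBA, ⟨hB1, fun t ht hc => ?_⟩, hB2⟩
  obtain ⟨s, hs, hsc, hsm, hstep⟩ := race_step hocc hac τ ι ⟨t, ht, hc⟩
  have := hmax (y := insert s B) ⟨hBA.trans (Set.subset_insert _ _), hsc, hB2.tail hstep⟩
    (Set.subset_insert _ _)
  exact hs (this (Or.inl rfl))

end timed

section main
variable {U W : PetriNet} {i o : W.P} {φ : NetMorphism U W}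

def Concl (U W : PetriNet) (φ : NetMorphism U W)
    (𝕋 : Set (W.T → ℝ≥0∞)) (𝕀 : Set (U.P → ℝ≥0∞)) : Prop :=
    ∃ τ ∈ 𝕋, ∃ τ' ∈ 𝕋, ∃ ι ∈ 𝕀, ∃ ι' ∈ 𝕀,
      (∀ u, τ' u ≤ τ u) ∧ (∀ p, ι' p ≤ ι p) ∧
      ∃ κ κ' : Set U.Node,
        U.Occurs (fun t => τ (φ.fT t)) ι κ ∧
        U.Occurs (fun t => τ' (φ.fT t)) ι' κ' ∧
        U.execTime (fun t => τ (φ.fT t)) ι κ <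
          U.execTime (fun t => τ' (φ.fT t)) ι' κ'

lemma Ctx.strategy [Fintype U.P] [Fintype U.T] (C : Ctx U W i o φ)
    (𝕋 : Set (W.T → ℝ≥0∞)) (𝕀 : Set (U.P → ℝ≥0∞))
    (hupT : ∀ τ ∈ 𝕋, ∀ τ' : W.T → ℝ≥0∞, (∀ u, τ u ≤ τ' u) → τ' ∈ 𝕋)
    (hfinT : ∃ τ' ∈ 𝕋, ∀ u : W.T, τ' u < ⊤)
    (hfinI : ∃ ι' ∈ 𝕀, ∀ p : U.P, ι' p < ⊤)
    (hcon : ¬ Concl U W φ 𝕋 𝕀)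
    {A0 A : Set U.T} {t' : U.T} (h0 : Cfg U A0)
    (hc' : Cfg U (insert t' A0)) (hA : Mx U A) (hss : A0 ⊆ A) (ht'A : t' ∉ A) :
    ∃ A', Mx U A' ∧ insert t' A0 ⊆ A' ∧ φ.fT '' A' ⊆ insert (φ.fT t') (φ.fT '' A) := by
  by_contra hno
  push Not at hno
  apply hcon
  obtain ⟨τs, hτs, hτf⟩ := hfinT
  obtain ⟨ι, hι, hιf⟩ := hfinI
  have hu' : φ.fT t' ∉ φ.fT '' A := C.fresh hA.1 h0 hss ht'A hc'
  obtain ⟨D, hD, hDb⟩ := date_bound C.occ C.ac hc' (fun t => τs (φ.fT t)) ι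
    (fun s _ => hτf _) hιf
  let S0 : Set W.T := φ.fT '' insert t' A0
  let S : Set W.T := insert (φ.fT t') (φ.fT '' A)
  let τ' : W.T → ℝ≥0∞ := fun x => if x ∈ S then (if x ∈ S0 then τs x else τs x + (D + 1)) else ⊤
  let τ : W.T → ℝ≥0∞ := fun x => if x ∈ φ.fT '' A then τ' x else ⊤
  have hS0S : S0 ⊆ S := by
    rintro _ ⟨s, rfl | hs, rfl⟩
    · exact Or.inl rfl
    · exact Or.inr ⟨s, hss hs, rfl⟩
  have e1 : ∀ x, τs x ≤ τ' x := by
    intro x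
    simp only [τ']
    split_ifs
    · exact le_rfl
    · exact le_self_add
    · exact le_top
  have e2 : ∀ x, τ' x ≤ τ x := by
    intro x
    simp only [τ]
    split_ifs
    · exact le_rfl
    · exact le_top
  have hτ' : τ' ∈ 𝕋 := hupT τs hτs τ' e1
  have hτ : τ ∈ 𝕋 := hupT τ' hτ' τ e2
  have fin' : ∀ x ∈ S, τ' x < ⊤ := by
    intro x hx
    simp only [τ', if_pos hx]
    split_ifs
    · exact hτf x
    · exact ENNReal.add_lt_top.2 ⟨hτf x, ENNReal.add_lt_top.2 ⟨hD, ENNReal.one_lt_top⟩⟩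
  -- the slow run
  obtain ⟨D1, hD1, hDb1⟩ := date_bound C.occ C.ac hA.1 (fun t => τ (φ.fT t)) ι
    (fun s hs => by
      have : φ.fT s ∈ φ.fT '' A := ⟨s, hs, rfl⟩
      simp only [τ, if_pos this]
      exact fin' _ (Or.inr this)) hιf
  have b1 := hDb1 (fun t => τ (φ.fT t)) (fun _ _ => le_rfl)
  have r1 : Relation.ReflTransGen (U.RaceStep (fun t => τ (φ.fT t)) ι) U.initConf (nodes U A) := by
    refine race_reach C.occ C.ac hA.1 _ ι D1 (fun s hs => b1 _ (by simpa using hs)) ?_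
    intro A1 s h1 hA1 hs hsc
    refine lt_of_lt_of_le hD1 (le_trans ?_ (le_date _ ι s))
    have : φ.fT s ∉ φ.fT '' A := C.fresh hA.1 h1 hA1 hs hsc
    simp only [τ, if_neg this]
    exact le_rfl
  -- the fast run
  have b2 := hDb (fun t => τ' (φ.fT t)) (fun s hs => by
    have : φ.fT s ∈ S0 := ⟨s, hs, rfl⟩
    simp only [τ', if_pos this, if_pos (hS0S this)]
    exact le_rfl)
  have r2 : Relation.ReflTransGen (U.RaceStep (fun t => τ' (φ.fT t)) ι) U.initConf
      (nodes U (insert t' A0)) := by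
    refine race_reach C.occ C.ac hc' _ ι D (fun s hs => b2 _ (inr_nodes.2 hs)) ?_
    intro A1 s h1 hA1 hs hsc
    refine lt_of_lt_of_le (ENNReal.lt_add_right hD.ne one_ne_zero) (le_trans ?_ (le_date _ ι s))
    have : φ.fT s ∉ S0 := C.fresh hc' h1 hA1 hs hsc
    simp only [τ', if_neg this]
    split_ifs
    · exact le_add_self
    · exact le_top
  obtain ⟨B, hAB, hB, r3⟩ := race_cont C.occ C.ac hc' (fun t => τ' (φ.fT t)) ι
  refine ⟨τ, hτ, τ', hτ', ι, hι, ι, hι, e2, fun _ => le_rfl, nodes U A, nodes U B,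
    ⟨r1, fun t ht => ?_⟩, ⟨r2.trans r3, fun t ht => ?_⟩, ?_⟩
  · have := (extends_iff C.occ C.ac A t).1 ht
    exact hA.2 t this.1 this.2
  · have := (extends_iff C.occ C.ac B t).1 ht
    exact hB.2 t this.1 this.2
  · have l1 : U.execTime (fun t => τ (φ.fT t)) ι (nodes U A) ≤ D1 := iSup₂_le b1
    refine lt_of_le_of_lt l1 (lt_of_lt_of_le hD1 ?_)
    obtain ⟨_, ⟨s, hs, rfl⟩, hsS⟩ := Set.not_subset.1 (hno B hB hAB)
    have : (⊤ : ℝ≥0∞) ≤ U.date (fun t => τ' (φ.fT t)) ι (Sum.inr s) := by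
      refine le_trans ?_ (le_date _ ι s)
      simp only [τ']
      rw [if_neg hsS]
    refine this.trans ?_
    exact le_iSup₂_of_le (f := fun x (_ : x ∈ nodes U B) => U.date (fun t => τ' (φ.fT t)) ι x)
      (Sum.inr s) (inr_nodes.2 hs) le_rfl

lemma Ctx.dyn [Fintype U.P] [Fintype U.T] (C : Ctx U W i o φ)
    (𝕋 : Set (W.T → ℝ≥0∞)) (𝕀 : Set (U.P → ℝ≥0∞))
    (hupT : ∀ τ ∈ 𝕋, ∀ τ' : W.T → ℝ≥0∞, (∀ u, τ u ≤ τ' u) → τ' ∈ 𝕋)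
    (hfinT : ∃ τ' ∈ 𝕋, ∀ u : W.T, τ' u < ⊤)
    (hfinI : ∃ ι' ∈ 𝕀, ∀ p : U.P, ι' p < ⊤)
    (hcon : ¬ Concl U W φ 𝕋 𝕀)
    {A0 : Set U.T} {t t' : U.T} (h0 : Cfg U A0)
    (hc : Cfg U (insert t A0)) (hc' : Cfg U (insert t' A0))
    (hne : t ≠ t') {p : U.P} (hp : p ∈ U.pre t) (hp' : p ∈ U.pre t') :
    Eqv W (φ.fT t) (φ.fT t') := by
  have hfin : {A : Set U.T | Mx U A ∧ insert t A0 ⊆ A}.Finite := Set.toFinite _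
  obtain ⟨A, ⟨hA, hsA⟩, hmin⟩ := Set.exists_min_image _ (fun A => (φ.fT '' A).ncard) hfin (by
    obtain ⟨B, h1, h2⟩ := exists_mx hc
    exact ⟨B, h2, h1⟩)
  have hnot : ∀ B, Cfg U B → t ∈ B → t' ∈ B → False := fun B hB h h' =>
    hne (hB.2 t h t' h' p hp hp')
  have htA : t' ∉ A := fun h => hnot A hA.1 (hsA (Or.inl rfl)) h
  obtain ⟨A', hA', hsA', hL'⟩ := C.strategy 𝕋 𝕀 hupT hfinT hfinI hcon h0 hc' hA
    ((Set.subset_insert _ _).trans hsA) htA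
  have htA' : t ∉ A' := fun h => hnot A' hA'.1 h (hsA' (Or.inl rfl))
  obtain ⟨A2, hA2, hsA2, hL2⟩ := C.strategy 𝕋 𝕀 hupT hfinT hfinI hcon h0 hc hA'
    ((Set.subset_insert _ _).trans hsA') htA'
  have htA2 : t' ∉ A2 := fun h => hnot A2 hA2.1 (hsA2 (Or.inl rfl)) h
  have f1 := C.fresh hA.1 h0 ((Set.subset_insert _ _).trans hsA) htA hc'
  have f2 := C.fresh hA2.1 h0 ((Set.subset_insert _ _).trans hsA2) htA2 hc'
  have f3 := C.fresh hA'.1 h0 ((Set.subset_insert _ _).trans hsA') htA' hc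
  have hu : φ.fT t ∈ φ.fT '' A := ⟨t, hsA (Or.inl rfl), rfl⟩
  have hu' : φ.fT t' ∈ φ.fT '' A' := ⟨t', hsA' (Or.inl rfl), rfl⟩
  have hsub : φ.fT '' A2 ⊆ φ.fT '' A := by
    intro v hv
    rcases hL2 hv with rfl | h
    · exact hu
    · rcases hL' h with rfl | h
      · exact (f2 hv).elim
      · exact h
  have heq : φ.fT '' A2 = φ.fT '' A :=
    Set.eq_of_subset_of_ncard_le hsub (hmin A2 ⟨hA2, hsA2⟩) (Set.toFinite _)
  have g1 : ∀ v, v ≠ φ.fT t → v ∈ φ.fT '' A → v ∈ φ.fT '' A' := by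
    intro v hv h
    rw [← heq] at h
    exact (hL2 h).resolve_left hv
  have g2 : ∀ v, v ≠ φ.fT t' → v ∈ φ.fT '' A' → v ∈ φ.fT '' A := fun v hv h =>
    (hL' h).resolve_left hv
  have s1 := C.swap_sub hA hA' hu g1
    (fun v hv h => ⟨g2 v hv h, fun e => f3 (e ▸ h)⟩)
  have s2 := C.swap_sub hA' hA hu' g2
    (fun v hv h => ⟨g1 v hv h, fun e => f1 (e ▸ h)⟩)
  exact ⟨s1.1.antisymm s2.1, s1.2.antisymm s2.2⟩

lemma Ctx.star [Fintype U.P] [Fintype U.T] (C : Ctx U W i o φ)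
    (𝕋 : Set (W.T → ℝ≥0∞)) (𝕀 : Set (U.P → ℝ≥0∞))
    (hupT : ∀ τ ∈ 𝕋, ∀ τ' : W.T → ℝ≥0∞, (∀ u, τ u ≤ τ' u) → τ' ∈ 𝕋)
    (hfinT : ∃ τ' ∈ 𝕋, ∀ u : W.T, τ' u < ⊤)
    (hfinI : ∃ ι' ∈ 𝕀, ∀ p : U.P, ι' p < ⊤)
    (hcon : ¬ Concl U W φ 𝕋 𝕀) : Star W i := by
  rintro M u v hr hu hv ⟨q, hqu, hqv⟩
  obtain ⟨L, hL⟩ := sq_of_reach hr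
  obtain ⟨A, _, hA, rfl, _⟩ := C.lift_sq hL ∅ cfg_empty C.cut_empty.1
  obtain ⟨t, rfl, ht, hc⟩ := C.exists_lift hA hu
  obtain ⟨t', rfl, ht', hc'⟩ := C.exists_lift hA hv
  by_cases hne : t = t'
  · subst hne; exact ⟨rfl, rfl⟩
  obtain ⟨p, hp, rfl⟩ := (φ.pre_bij t).surjOn hqu
  obtain ⟨p', hp', he⟩ := (φ.pre_bij t').surjOn hqv
  have := (C.cut_inv hA).2 (ht' hp') (ht hp) he
  subst this
  exact C.dyn 𝕋 𝕀 hupT hfinT hfinI hcon hA hc hc' hne hp hp'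

end main

end Mono

/-- Theorem 3, necessity: for a sound workflow net `W` with unfolding
    `(U, φ)`, if the allowed latency/initial-date families are upward closed and
    contain an everywhere-finite member, then a violation of the cluster condition
    (a cluster with two transitions having different postsets) implies that the
    induced pre-OrchNet is not monotonic. -/
theorem stmt14 (W : PetriNet) (i o : W.P)
    (hwf : IsWorkflow W i o) (hsound : IsSound W i o)
    (hsafe : IsSafe W i) (hloopfree : LoopFree W)
    (U : PetriNet) [Fintype U.P] [Fintype U.T]
    (φ : NetMorphism U W) (hunf : IsUnfolding U W φ)
    (𝕋 : Set (W.T → ℝ≥0∞)) (𝕀 : Set (U.P → ℝ≥0∞))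
    (hupT : ∀ τ ∈ 𝕋, ∀ τ' : W.T → ℝ≥0∞, (∀ u, τ u ≤ τ' u) → τ' ∈ 𝕋)
    (hupI : ∀ ι ∈ 𝕀, ∀ ι' : U.P → ℝ≥0∞, (∀ p, ι p ≤ ι' p) → ι' ∈ 𝕀)
    (hfinT : ∃ τ' ∈ 𝕋, ∀ u : W.T, τ' u < ⊤)
    (hfinI : ∃ ι' ∈ 𝕀, ∀ p : U.P, ι' p < ⊤)
    -- violation of the cluster condition
    (hviol : ∃ c : Set W.Node, W.IsCluster c ∧
      ∃ t1 t2 : W.T, Sum.inr t1 ∈ c ∧ Sum.inr t2 ∈ c ∧ t1 ≠ t2 ∧ W.post t1 ≠ W.post t2) :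
    -- non-monotony of the induced pre-OrchNet on the unfolding `U`
    ∃ τ ∈ 𝕋, ∃ τ' ∈ 𝕋, ∃ ι ∈ 𝕀, ∃ ι' ∈ 𝕀,
      (∀ u, τ' u ≤ τ u) ∧ (∀ p, ι' p ≤ ι p) ∧
      ∃ κ κ' : Set U.Node,
        U.Occurs (fun t => τ (φ.fT t)) ι κ ∧
        U.Occurs (fun t => τ' (φ.fT t)) ι' κ' ∧
        U.execTime (fun t => τ (φ.fT t)) ι κ <
          U.execTime (fun t => τ' (φ.fT t)) ι' κ' := by
  by_contra hcon
  have C : Mono.Ctx U W i o φ := ⟨hwf, hsound, hsafe, hloopfree, hunf⟩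
  obtain ⟨u, u', q, h1, h2, h3⟩ := Mono.cluster_viol hviol
  exact h3 (C.star_static (C.star 𝕋 𝕀 hupT hfinT hfinI hcon) h1 h2)
end
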